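/- arXiv:1410.3719 — 3 statements merged into one kernel-verified Lean document; each statement's English description precedes it below -/
import Mathlib

section
/- Suppose the equation of state f satisfies (f1), (f2), liminf_{s→∞} f(s)s^{−γ} > 0 for some γ > 4/3, and f is continuously differentiable on (0,∞) with liminf_{s→0} f'(s)s^{−μ} > 0 for some μ > 0. Let K be a bounded axisymmetric domain satisfying the no-trapping condition, let Φ_K = Bρ_K be the Newtonian potential of a given nonnegative axisymmetric ρ_K ∈ L^q(K) with q > 3, and let M > 0. Then there exists Ω₀ > 0 such that for every constant angular velocity Ω > Ω₀ (so J(r) = ½Ω²r²) there is no bounded continuous function ρ : ℝ³∖K → [0,∞) with ∫_{ℝ³∖K} ρ(x) dx = M satisfying, for some constant λ, the equilibrium relation A'(ρ) − Bρ − J − Φ_K = λ on the set where ρ is positive. -/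
open MeasureTheory Filter Set Topology

noncomputable section

abbrev R3 : Type := EuclideanSpace ℝ (Fin 3)

def rot (θ : ℝ) (x : R3) : R3 :=
  (EuclideanSpace.equiv (Fin 3) ℝ).symm
    ![Real.cos θ * x 0 - Real.sin θ * x 1,
      Real.sin θ * x 0 + Real.cos θ * x 1,
      x 2]

def AxisymmetricFun (g : R3 → ℝ) : Prop := ∀ (θ : ℝ) (x : R3), g (rot θ x) = g x

def AxisymmetricSet (K : Set R3) : Prop := ∀ (θ : ℝ) (x : R3), x ∈ K → rot θ x ∈ K

def rcyl (x : R3) : ℝ := Real.sqrt (x 0 ^ 2 + x 1 ^ 2)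

def Bpot (K : Set R3) (ρ : R3 → ℝ) (x : R3) : ℝ := ∫ y in Kᶜ, ρ y / ‖x - y‖

def Afun (f : ℝ → ℝ) (s : ℝ) : ℝ := s * ∫ t in (0:ℝ)..s, f t / t ^ 2

def F1 (f : ℝ → ℝ) : Prop :=
  (∀ s, 0 < s → 0 ≤ f s) ∧ ContinuousOn f (Ioi 0) ∧ StrictMonoOn f (Ioi 0)

def F2 (f : ℝ → ℝ) : Prop :=
  Tendsto (fun s => f s / s ^ ((4:ℝ)/3)) (nhdsWithin 0 (Ioi 0)) (nhds 0) ∧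
  Tendsto (fun s => f s / s ^ ((4:ℝ)/3)) atTop atTop

def PhiCond (Φ : R3 → ℝ) : Prop :=
  ContDiff ℝ 1 Φ ∧ (∀ x, 0 < Φ x) ∧ AxisymmetricFun Φ ∧
  Tendsto Φ (cocompact R3) (nhds 0) ∧
  ∃ z₀ > 0, ∀ x y : R3, x 0 = y 0 → x 1 = y 1 →
    z₀ < |x 2| → |x 2| ≤ |y 2| → 0 ≤ x 2 * y 2 → Φ y ≤ Φ x

def SolvesEP (K : Set R3) (f : ℝ → ℝ) (J Φ : R3 → ℝ) (ρ : R3 → ℝ) : Prop :=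
  ∀ x ∈ Kᶜ, 0 < ρ x →
    DifferentiableAt ℝ ρ x ∧
    DifferentiableAt ℝ (fun y => f (ρ y)) x ∧
    DifferentiableAt ℝ (fun y => Bpot K ρ y + J y + Φ y) x ∧
    fderiv ℝ (fun y => f (ρ y)) x = ρ x • fderiv ℝ (fun y => Bpot K ρ y + J y + Φ y) x

def IsRotatingSolution (K : Set R3) (f : ℝ → ℝ) (J Φ : R3 → ℝ) (M : ℝ) (ρ : R3 → ℝ) : Prop :=
  ContinuousOn ρ Kᶜ ∧ (∀ x, 0 ≤ ρ x) ∧ HasCompactSupport ρ ∧ AxisymmetricFun ρ ∧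
  SolvesEP K f J Φ ρ ∧ (∫ x in Kᶜ, ρ x) = M

def Jprof (Ω : ℝ → ℝ) (x : R3) : ℝ := ∫ s in (0:ℝ)..(rcyl x), s * Ω s ^ 2

def Jconst (Ω : ℝ) (x : R3) : ℝ := (1/2) * Ω ^ 2 * rcyl x ^ 2

def OmegaCond (Ω : ℝ → ℝ) : Prop :=
  (∀ s, 0 ≤ s → 0 ≤ s * Ω s ^ 2) ∧ ContinuousOn (fun s => s * Ω s ^ 2) (Ici 0) ∧
  IntegrableOn (fun s => s * Ω s ^ 2) (Ici 0)

/-- The horizontal (cylindrical radial) part of a point. -/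
def horiz (x : R3) : R3 :=
  (EuclideanSpace.equiv (Fin 3) ℝ).symm ![x 0, x 1, 0]

/-- The "no trapping" condition on the core `K`. -/
def NoTrapping (K : Set R3) : Prop :=
  ∀ x ∈ Kᶜ, ∀ t : ℝ, 0 ≤ t → x + t • horiz x ∈ Kᶜ

/-- `A'(s) = ∫₀^s f(t)/t² dt + f(s)/s`. -/
def Aprime (f : ℝ → ℝ) (s : ℝ) : ℝ := (∫ t in (0:ℝ)..s, f t / t ^ 2) + f s / s

/-- Newtonian potential of the core density `ρ_K`, integrated over `K`. -/
def BpotK (K : Set R3) (ρK : R3 → ℝ) (x : R3) : ℝ := ∫ y in K, ρK y / ‖x - y‖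

/-- The kernel `s ^ (-β)` truncated to `s < h`. -/
def truncKernel (β h : ℝ) (s : ℝ) : ℝ := (Iio h).indicator (fun s => s ^ (-β)) s

lemma truncKernel_nonneg {β h s : ℝ} (hs : 0 ≤ s) : 0 ≤ truncKernel β h s :=
  indicator_apply_nonneg fun _ => by positivity

lemma truncKernel_of_lt {β h s : ℝ} (hs : s < h) : truncKernel β h s = s ^ (-β) :=
  indicator_of_mem (mem_Iio.2 hs) _

lemma truncKernel_radial_integrableOn {β h : ℝ} (hβ : β < 3) (hh : 0 < h) :
    IntegrableOn (fun s : ℝ => s ^ (3 - 1) • truncKernel β h s) (Ioi 0) ∧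
      ∫ s in Ioi (0 : ℝ), s ^ (3 - 1) • truncKernel β h s = h ^ (3 - β) / (3 - β) := by
  have key : ∀ s ∈ Ioi (0 : ℝ), s ^ (3 - 1) • truncKernel β h s
      = (Ioo 0 h).indicator (fun s => s ^ (2 - β)) s := by
    intro s hs
    have hs' : 0 < s := hs
    by_cases hsh : s < h
    · rw [truncKernel_of_lt hsh, indicator_of_mem (by exact ⟨hs', hsh⟩), smul_eq_mul,
        sub_eq_add_neg, Real.rpow_add hs']
      norm_num
    · simp [truncKernel, hsh]
  have hint : IntervalIntegrable (fun s : ℝ => s ^ (2 - β)) volume 0 h :=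
    intervalIntegral.intervalIntegrable_rpow' (by linarith)
  constructor
  · rw [integrableOn_congr_fun key measurableSet_Ioi]
    refine IntegrableOn.mono_set ?_ (subset_univ _)
    rw [integrableOn_univ, integrable_indicator_iff measurableSet_Ioo]
    exact ((intervalIntegrable_iff_integrableOn_Ioc_of_le hh.le).1 hint).mono_set Ioo_subset_Ioc_self
  · rw [setIntegral_congr_fun measurableSet_Ioi key, setIntegral_indicator measurableSet_Ioo,
      show Ioi (0 : ℝ) ∩ Ioo 0 h = Ioo 0 h from inter_eq_right.2 (fun s hs => hs.1),
      ← integral_Ioc_eq_integral_Ioo, ← intervalIntegral.integral_of_le hh.le,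
      integral_rpow (Or.inl (by linarith)), show 2 - β + 1 = 3 - β by ring,
      Real.zero_rpow (by linarith), sub_zero]

lemma integrable_truncKernel {β h : ℝ} (hβ : β < 3) (hh : 0 < h) (x : R3) :
    Integrable (fun y : R3 => truncKernel β h ‖x - y‖) := by
  have := (integrable_fun_norm_addHaar (volume : Measure R3) (f := truncKernel β h)).2 (by
    simpa using (truncKernel_radial_integrableOn hβ hh).1)
  exact this.comp_sub_left x

lemma integral_truncKernel {β h : ℝ} (hβ : β < 3) (hh : 0 < h) (x : R3) :
    ∫ y : R3, truncKernel β h ‖x - y‖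
      = 3 * volume.real (Metric.ball (0 : R3) 1) * (h ^ (3 - β) / (3 - β)) := by
  rw [integral_sub_left_eq_self (fun y : R3 => truncKernel β h ‖y‖) volume x,
    integral_fun_norm_addHaar (volume : Measure R3)]
  have := (truncKernel_radial_integrableOn hβ hh).2
  simp only [finrank_euclideanSpace, Fintype.card_fin]
  rw [this, nsmul_eq_mul, smul_eq_mul]
  push_cast
  ring

lemma rcyl_nonneg (x : R3) : 0 ≤ rcyl x := Real.sqrt_nonneg _

lemma rcyl_sq (x : R3) : rcyl x ^ 2 = x 0 ^ 2 + x 1 ^ 2 := Real.sq_sqrt (by positivity)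

lemma norm_sq_eq (x : R3) : ‖x‖ ^ 2 = x 0 ^ 2 + x 1 ^ 2 + x 2 ^ 2 := by
  rw [EuclideanSpace.norm_sq_eq]
  simp [Fin.sum_univ_three]

lemma abs_coord_le_norm (x : R3) (i : Fin 3) : |x i| ≤ ‖x‖ := by
  simpa using PiLp.norm_apply_le x i

lemma abs_coord_zero_le_rcyl (x : R3) : |x 0| ≤ rcyl x :=
  Real.abs_le_sqrt (by nlinarith [sq_nonneg (x 1)])

lemma abs_coord_one_le_rcyl (x : R3) : |x 1| ≤ rcyl x :=
  Real.abs_le_sqrt (by nlinarith [sq_nonneg (x 0)])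

/-- An integrable majorant of the squared inverse distance on the cylinder of radius `α`, away
from the singularity. -/
def cylKernel (α c : ℝ) (y : R3) : ℝ :=
  (Icc (-α) α).indicator 1 (y 0) * (Icc (-α) α).indicator 1 (y 1) *
    (2 * α⁻¹ ^ 2 * (1 + ((y 2 - c) / α) ^ 2)⁻¹)

lemma cylKernel_integrable {α : ℝ} (hα : 0 < α) (c : ℝ) :
    Integrable (cylKernel α c) ∧ ∫ y, cylKernel α c y = 8 * Real.pi * α := by
  let F : Fin 3 → ℝ → ℝ := ![(Icc (-α) α).indicator 1, (Icc (-α) α).indicator 1,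
    fun t => 2 * α⁻¹ ^ 2 * (1 + ((t - c) / α) ^ 2)⁻¹]
  have hF : cylKernel α c = fun y : R3 => (fun z : Fin 3 → ℝ => ∏ i, F i (z i)) (WithLp.ofLp y) := by
    funext y
    simp [cylKernel, F, Fin.prod_univ_three]
  have hmp := PiLp.volume_preserving_ofLp (Fin 3)
  have hemb : MeasurableEmbedding (@WithLp.ofLp 2 (Fin 3 → ℝ)) :=
    (MeasurableEquiv.toLp 2 (Fin 3 → ℝ)).symm.measurableEmbedding
  have h01 : Integrable ((Icc (-α) α).indicator (1 : ℝ → ℝ)) :=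
    (integrable_indicator_iff measurableSet_Icc).2 (by simp [Pi.one_def])
  have h2 : Integrable (fun t : ℝ => 2 * α⁻¹ ^ 2 * (1 + ((t - c) / α) ^ 2)⁻¹) :=
    ((integrable_inv_one_add_sq.comp_div hα.ne').comp_sub_right c).const_mul _
  have hi : ∀ i, Integrable (F i) := by
    intro i
    fin_cases i
    exacts [h01, h01, h2]
  rw [hF]
  constructor
  · exact (hmp.integrable_comp_emb hemb).2 (Integrable.fintype_prod hi)
  · rw [hmp.integral_comp hemb (fun z : Fin 3 → ℝ => ∏ i, F i (z i)),
      integral_fintype_prod_volume_eq_prod F, Fin.prod_univ_three]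
    have e0 : ∫ t, (Icc (-α) α).indicator (1 : ℝ → ℝ) t = 2 * α := by
      rw [integral_indicator measurableSet_Icc]
      simp [hα.le]
      ring
    have e2 : ∫ t : ℝ, 2 * α⁻¹ ^ 2 * (1 + ((t - c) / α) ^ 2)⁻¹ = 2 * α⁻¹ * Real.pi := by
      rw [integral_const_mul,
        integral_sub_right_eq_self (fun t : ℝ => (1 + (t / α) ^ 2)⁻¹) c,
        Measure.integral_comp_div (fun t : ℝ => (1 + t ^ 2)⁻¹) α, integral_univ_inv_one_add_sq,
        abs_of_pos hα, smul_eq_mul]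
      field_simp
    have : (∫ t, F 0 t) * (∫ t, F 1 t) * (∫ t, F 2 t) = (2 * α) * (2 * α) * (2 * α⁻¹ * Real.pi) := by
      simp only [F, Matrix.cons_val_zero, Matrix.cons_val_one, Matrix.cons_val]
      rw [e0, e2]
    rw [this]
    field_simp
    ring

/-- The measure of a unit slab of a cylinder. -/
lemma volume_slab_le (a c : ℝ) :
    volume {y : R3 | rcyl y ≤ a ∧ c ≤ y 2 ∧ y 2 ≤ c + 1} ≤ ENNReal.ofReal (2 * a) ^ 2 := by
  have hmp := PiLp.volume_preserving_ofLp (Fin 3)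
  have hsub : {y : R3 | rcyl y ≤ a ∧ c ≤ y 2 ∧ y 2 ≤ c + 1} ⊆
      (@WithLp.ofLp 2 (Fin 3 → ℝ)) ⁻¹' (Icc ![-a, -a, c] ![a, a, c + 1]) := by
    rintro y ⟨h, h1, h2⟩
    have h3 := abs_le.1 ((abs_coord_zero_le_rcyl y).trans h)
    have h4 := abs_le.1 ((abs_coord_one_le_rcyl y).trans h)
    constructor <;> intro i <;> fin_cases i <;> simp_all
  refine (measure_mono hsub).trans ?_
  rw [hmp.measure_preimage measurableSet_Icc.nullMeasurableSet, Real.volume_Icc_pi,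
    Fin.prod_univ_three]
  apply le_of_eq
  simp only [Matrix.cons_val_zero, Matrix.cons_val_one, Matrix.cons_val, sub_neg_eq_add,
    add_sub_cancel_left, ENNReal.ofReal_one, mul_one]
  rw [← two_mul, sq]

/-- The volume constant appearing in integrals of radial kernels. -/
def radialConst : ℝ := 3 * volume.real (Metric.ball (0 : R3) 1)

lemma radialConst_nonneg : 0 ≤ radialConst := by unfold radialConst; positivity

lemma truncKernel_one {h s : ℝ} (hs : s < h) : truncKernel 1 h s = 1 / s := by
  rw [truncKernel_of_lt hs, Real.rpow_neg_one, one_div]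

lemma truncKernel_two {h s : ℝ} (hs0 : 0 ≤ s) (hs : s < h) : truncKernel 2 h s = 1 / s ^ 2 := by
  rw [truncKernel_of_lt hs, Real.rpow_neg hs0, Real.rpow_two, one_div]

lemma aestronglyMeasurable_div_norm {g : R3 → ℝ} (hg : AEStronglyMeasurable g) (x : R3) :
    AEStronglyMeasurable (fun y => g y / ‖x - y‖) := by
  simp only [div_eq_mul_inv]
  exact hg.mul (Measurable.aestronglyMeasurable (by fun_prop))

lemma aestronglyMeasurable_div_norm_sq {g : R3 → ℝ} (hg : AEStronglyMeasurable g) (x : R3) :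
    AEStronglyMeasurable (fun y => g y / ‖x - y‖ ^ 2) := by
  simp only [div_eq_mul_inv]
  exact hg.mul (Measurable.aestronglyMeasurable (by fun_prop))

lemma integrable_and_integral_le {α : Type*} [MeasurableSpace α] {m : Measure α} {u v : α → ℝ}
    (hu : AEStronglyMeasurable u m) (hu0 : ∀ y, 0 ≤ u y) (hv : Integrable v m)
    (huv : ∀ᵐ y ∂m, u y ≤ v y) : Integrable u m ∧ ∫ y, u y ∂m ≤ ∫ y, v y ∂m := by
  refine ⟨hv.mono' hu ?_, integral_mono_of_nonneg (Eventually.of_forall hu0) hv huv⟩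
  filter_upwards [huv] with y hy
  rwa [Real.norm_of_nonneg (hu0 y)]

lemma potential_le {g : R3 → ℝ} (hg : Integrable g) (hg0 : ∀ y, 0 ≤ g y) {R : ℝ}
    (hgR : ∀ᵐ y, g y ≤ R) (hR : 0 ≤ R) {h : ℝ} (hh : 0 < h) (x : R3) :
    Integrable (fun y => g y / ‖x - y‖) ∧
      ∫ y, g y / ‖x - y‖ ≤ R * (radialConst * (h ^ 2 / 2)) + (∫ y, g y) / h := by
  have hk := (integrable_truncKernel (β := 1) (by norm_num) hh x).const_mul R
  have := integrable_and_integral_le (aestronglyMeasurable_div_norm hg.1 x)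
    (fun y => div_nonneg (hg0 y) (norm_nonneg _)) (hk.add (hg.div_const h)) (by
      filter_upwards [hgR] with y hy
      simp only [Pi.add_apply]
      have h1 := hg0 y
      have h2 := norm_nonneg (x - y)
      by_cases hlt : ‖x - y‖ < h
      · rw [truncKernel_one hlt, mul_one_div]
        have : g y / ‖x - y‖ ≤ R / ‖x - y‖ := by gcongr
        have : 0 ≤ g y / h := by positivity
        linarith
      · push Not at hlt
        have : g y / ‖x - y‖ ≤ g y / h := by gcongr
        have := mul_nonneg hR (truncKernel_nonneg (β := 1) (h := h) h2)
        linarith)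
  refine ⟨this.1, this.2.trans_eq ?_⟩
  simp only [Pi.add_apply]
  rw [integral_add hk (hg.div_const h), integral_const_mul,
    integral_truncKernel (by norm_num) hh x, integral_div, radialConst]
  norm_num

lemma potential_sq_le {g : R3 → ℝ} (hg : Integrable g) (hg0 : ∀ y, 0 ≤ g y) {R : ℝ}
    (hgR : ∀ᵐ y, g y ≤ R) (hR : 0 ≤ R) (x : R3) :
    Integrable (fun y => g y / ‖x - y‖ ^ 2) ∧
      ∫ y, g y / ‖x - y‖ ^ 2 ≤ R * radialConst + ∫ y, g y := by
  have hk := (integrable_truncKernel (β := 2) (by norm_num) one_pos x).const_mul R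
  have := integrable_and_integral_le (aestronglyMeasurable_div_norm_sq hg.1 x)
    (fun y => div_nonneg (hg0 y) (by positivity)) (hk.add hg) (by
      filter_upwards [hgR] with y hy
      simp only [Pi.add_apply]
      have h1 := hg0 y
      have h2 := norm_nonneg (x - y)
      by_cases hlt : ‖x - y‖ < 1
      · rw [truncKernel_two h2 hlt, mul_one_div]
        have : g y / ‖x - y‖ ^ 2 ≤ R / ‖x - y‖ ^ 2 := by gcongr
        linarith
      · push Not at hlt
        have : g y / ‖x - y‖ ^ 2 ≤ g y := div_le_self h1 (one_le_pow₀ hlt)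
        have := mul_nonneg hR (truncKernel_nonneg (β := 2) (h := 1) h2)
        linarith)
  refine ⟨this.1, this.2.trans_eq ?_⟩
  simp only [Pi.add_apply]
  rw [integral_add hk hg, integral_const_mul, integral_truncKernel (by norm_num) one_pos x,
    radialConst]
  norm_num

lemma potential_sq_le_of_rpow {g : R3 → ℝ} (hg : Integrable g) (hg0 : ∀ y, 0 ≤ g y) {q : ℝ}
    (hq : 3 < q) (hgq : Integrable fun y => g y ^ q) :
    ∃ C, 0 ≤ C ∧ ∀ x : R3, Integrable (fun y => g y / ‖x - y‖ ^ 2) ∧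
      ∫ y, g y / ‖x - y‖ ^ 2 ≤ C := by
  set p := q.conjExponent with hp
  have hpq : p.HolderConjugate q := (Real.HolderConjugate.conjExponent (by linarith)).symm
  have hp3 : 2 * p < 3 := by
    rw [hp, Real.conjExponent, ← mul_div_assoc, div_lt_iff₀ (by linarith)]
    linarith
  have hp1 : 1 < p := hpq.lt
  have hC : 0 ≤ (1 : ℝ) ^ (3 - 2 * p) / (3 - 2 * p) := by
    rw [Real.one_rpow]
    exact div_nonneg zero_le_one (by linarith)
  refine ⟨(∫ y, g y ^ q) + radialConst * (1 ^ (3 - 2 * p) / (3 - 2 * p)) + ∫ y, g y, ?_,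
    fun x => ?_⟩
  · have h1 : 0 ≤ ∫ y, g y ^ q := integral_nonneg fun y => Real.rpow_nonneg (hg0 y) _
    have h2 : 0 ≤ ∫ y, g y := integral_nonneg hg0
    have := mul_nonneg radialConst_nonneg hC
    positivity
  have hk := integrable_truncKernel hp3 one_pos x
  have := integrable_and_integral_le (aestronglyMeasurable_div_norm_sq hg.1 x)
    (fun y => div_nonneg (hg0 y) (by positivity)) ((hgq.add hk).add hg) (by
      refine Eventually.of_forall fun y => ?_
      simp only [Pi.add_apply]
      have h1 := hg0 y
      have h2 := norm_nonneg (x - y)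
      have h3 := Real.rpow_nonneg h1 q
      by_cases hlt : ‖x - y‖ < 1
      · rw [truncKernel_of_lt hlt]
        have hy := Real.young_inequality_of_nonneg (a := (‖x - y‖ ^ 2)⁻¹) (b := g y)
          (by positivity) h1 hpq
        have e : ((‖x - y‖ ^ 2)⁻¹) ^ p = ‖x - y‖ ^ (-(2 * p)) := by
          rw [Real.rpow_neg h2, Real.rpow_mul h2, Real.rpow_two, Real.inv_rpow (by positivity)]
        rw [e] at hy
        have h4 : ‖x - y‖ ^ (-(2 * p)) / p ≤ ‖x - y‖ ^ (-(2 * p)) :=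
          div_le_self (by positivity) hp1.le
        have h5 : g y ^ q / q ≤ g y ^ q := div_le_self h3 (by linarith)
        rw [div_eq_inv_mul]
        linarith
      · push Not at hlt
        have : g y / ‖x - y‖ ^ 2 ≤ g y := div_le_self h1 (one_le_pow₀ hlt)
        have := truncKernel_nonneg (β := 2 * p) (h := 1) h2
        linarith)
  refine ⟨this.1, this.2.trans_eq ?_⟩
  rw [integral_add' (hgq.add hk) hg, integral_add' hgq hk, integral_truncKernel hp3 one_pos x,
    radialConst]

lemma potential_le_of_sq {g : R3 → ℝ} (hg : Integrable g) (hg0 : ∀ y, 0 ≤ g y) (x : R3)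
    (hgx : Integrable fun y => g y / ‖x - y‖ ^ 2) :
    Integrable (fun y => g y / ‖x - y‖) ∧
      ∫ y, g y / ‖x - y‖ ≤ (∫ y, g y) + ∫ y, g y / ‖x - y‖ ^ 2 := by
  have := integrable_and_integral_le (aestronglyMeasurable_div_norm hg.1 x)
    (fun y => div_nonneg (hg0 y) (norm_nonneg _)) (hg.add hgx) (by
      refine Eventually.of_forall fun y => ?_
      have h1 := hg0 y
      have h2 : 1 / ‖x - y‖ ≤ 1 + (1 / ‖x - y‖) ^ 2 := by nlinarith [sq_nonneg (1 / ‖x - y‖ - 1)]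
      have h3 := mul_le_mul_of_nonneg_left h2 h1
      simp only [Pi.add_apply]
      calc g y / ‖x - y‖ = g y * (1 / ‖x - y‖) := by ring
        _ ≤ _ := h3
        _ = _ := by ring)
  rw [← integral_add hg hgx]
  exact this

/-- A difference quotient bound for Newtonian potentials in terms of the potentials of the
squared kernel at both ends. -/
lemma potential_sub_le {g : R3 → ℝ} (hg0 : ∀ y, 0 ≤ g y) {x x' : R3}
    (h1 : Integrable fun y => g y / ‖x - y‖) (h1' : Integrable fun y => g y / ‖x' - y‖)
    (h2 : Integrable fun y => g y / ‖x - y‖ ^ 2) (h2' : Integrable fun y => g y / ‖x' - y‖ ^ 2) :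
    (∫ y, g y / ‖x - y‖) - ∫ y, g y / ‖x' - y‖ ≤
      ‖x - x'‖ / 2 * ((∫ y, g y / ‖x - y‖ ^ 2) + ∫ y, g y / ‖x' - y‖ ^ 2) := by
  rw [← integral_sub h1 h1', ← integral_add h2 h2', ← integral_const_mul]
  refine integral_mono_ae (h1.sub h1') ((h2.add h2').const_mul _) ?_
  filter_upwards [compl_mem_ae_iff.2 (measure_singleton x),
    compl_mem_ae_iff.2 (measure_singleton x')] with y hy hy'
  have ha : 0 < ‖x - y‖ := norm_pos_iff.2 (sub_ne_zero.2 fun h => hy h.symm)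
  have hb : 0 < ‖x' - y‖ := norm_pos_iff.2 (sub_ne_zero.2 fun h => hy' h.symm)
  have hd : ‖x' - y‖ ≤ ‖x - y‖ + ‖x - x'‖ := by
    have := norm_sub_le (x - y) (x - x')
    rwa [show x - y - (x - x') = x' - y by abel] at this
  set a := ‖x - y‖
  set b := ‖x' - y‖
  set d := ‖x - x'‖
  have hd0 : 0 ≤ d := norm_nonneg _
  have key : 1 / a - 1 / b ≤ d / 2 * (1 / a ^ 2 + 1 / b ^ 2) := by
    have e1 : 1 / a - 1 / b = (b - a) * (1 / a * (1 / b)) := by field_simp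
    have e2 : (b - a) * (1 / a * (1 / b)) ≤ d * (1 / a * (1 / b)) := by
      gcongr
      linarith
    have e3 : 1 / a * (1 / b) ≤ 1 / 2 * ((1 / a) ^ 2 + (1 / b) ^ 2) := by
      nlinarith [sq_nonneg (1 / a - 1 / b)]
    have e4 := mul_le_mul_of_nonneg_left e3 hd0
    calc _ ≤ _ := e1.trans_le e2
      _ ≤ _ := e4
      _ = _ := by ring
  have := mul_le_mul_of_nonneg_left key (hg0 y)
  calc g y / a - g y / b = g y * (1 / a - 1 / b) := by ring
    _ ≤ _ := this
    _ = _ := by ring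

lemma inv_dist_sq_le_cyl {α : ℝ} (hα : 0 < α) {x y : R3} (hy : rcyl y ≤ α) :
    1 / ‖x - y‖ ^ 2 ≤ truncKernel 2 α ‖x - y‖ + cylKernel α (x 2) y := by
  have hc0 := abs_le.1 ((abs_coord_zero_le_rcyl y).trans hy)
  have hc1 := abs_le.1 ((abs_coord_one_le_rcyl y).trans hy)
  have hcyl : cylKernel α (x 2) y = 2 / (α ^ 2 + (y 2 - x 2) ^ 2) := by
    rw [cylKernel, indicator_of_mem (by exact hc0), indicator_of_mem (by exact hc1)]
    simp only [Pi.one_apply, one_mul]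
    field_simp
  rw [hcyl]
  by_cases hlt : ‖x - y‖ < α
  · rw [truncKernel_two (norm_nonneg _) hlt]
    have : 0 ≤ 2 / (α ^ 2 + (y 2 - x 2) ^ 2) := by positivity
    linarith
  · push Not at hlt
    have h1 : α ^ 2 ≤ ‖x - y‖ ^ 2 := by gcongr
    have h2 : (y 2 - x 2) ^ 2 ≤ ‖x - y‖ ^ 2 := by
      have := abs_coord_le_norm (x - y) 2
      have e : (y 2 - x 2) ^ 2 = |(x - y) 2| ^ 2 := by
        rw [sq_abs, PiLp.sub_apply]
        ring
      rw [e]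
      gcongr
    have hpos := hα.trans_le hlt
    have h3 : 1 / ‖x - y‖ ^ 2 ≤ 2 / (α ^ 2 + (y 2 - x 2) ^ 2) := by
      rw [div_le_div_iff₀ (by positivity) (by positivity)]
      linarith
    have := truncKernel_nonneg (β := 2) (h := α) (norm_nonneg (x - y))
    linarith

lemma cylKernel_nonneg (α c : ℝ) (y : R3) : 0 ≤ cylKernel α c y := by
  unfold cylKernel
  have h (t : ℝ) : 0 ≤ (Icc (-α) α).indicator (1 : ℝ → ℝ) t :=
    indicator_apply_nonneg fun _ => zero_le_one
  have h0 := h (y 0)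
  have h1 := h (y 1)
  positivity

/-- A weight depending only on the heights, dominating the squared inverse distance between
points of unit slabs that are not adjacent. -/
def slabWeight (k : ℤ) (y : R3) : ℝ := 8 / (1 + ((k : ℝ) - ⌊y 2⌋) ^ 2)

lemma slabWeight_nonneg (k : ℤ) (y : R3) : 0 ≤ slabWeight k y := by
  unfold slabWeight; positivity

lemma slabWeight_le (k : ℤ) (y : R3) : slabWeight k y ≤ 8 :=
  div_le_self (by norm_num) (by nlinarith [sq_nonneg ((k : ℝ) - ⌊y 2⌋)])

lemma measurable_slabWeight (k : ℤ) : Measurable (slabWeight k) := by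
  unfold slabWeight
  have h : Measurable fun y : R3 => y 2 := by fun_prop
  have h2 : Measurable fun y : R3 => ((⌊y 2⌋ : ℤ) : ℝ) := measurable_from_top.comp h.floor
  fun_prop

lemma integrable_mul_slabWeight {g : R3 → ℝ} (hg : Integrable g) (hg0 : ∀ y, 0 ≤ g y) (k : ℤ) :
    Integrable (fun y => g y * slabWeight k y) := by
  refine (hg.mul_const 8).mono' (hg.1.mul (measurable_slabWeight k).aestronglyMeasurable)
    (Eventually.of_forall fun y => ?_)
  rw [Real.norm_of_nonneg (mul_nonneg (hg0 y) (slabWeight_nonneg k y))]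
  exact mul_le_mul_of_nonneg_left (slabWeight_le k y) (hg0 y)

lemma inv_dist_sq_le_slabWeight {x y : R3} (h : 2 ≤ |⌊x 2⌋ - ⌊y 2⌋|) :
    1 / ‖x - y‖ ^ 2 ≤ slabWeight ⌊x 2⌋ y := by
  set j : ℝ := (⌊x 2⌋ : ℝ) - ⌊y 2⌋ with hj
  have hj2 : 2 ≤ |j| := by
    have : ((2 : ℤ) : ℝ) ≤ ((|⌊x 2⌋ - ⌊y 2⌋| : ℤ) : ℝ) := by exact_mod_cast h
    simpa [hj] using this
  have h1 : |j| / 2 ≤ |x 2 - y 2| := by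
    have := Int.floor_le (x 2)
    have := Int.lt_floor_add_one (x 2)
    have := Int.floor_le (y 2)
    have := Int.lt_floor_add_one (y 2)
    rcases le_total 0 j with h0 | h0
    · rw [abs_of_nonneg h0] at hj2 ⊢
      exact le_trans (by linarith) (le_abs_self _)
    · rw [abs_of_nonpos h0] at hj2 ⊢
      exact le_trans (by linarith) (neg_le_abs _)
  have h2 : |j| / 2 ≤ ‖x - y‖ := h1.trans (abs_coord_le_norm (x - y) 2)
  have h3 : (|j| / 2) ^ 2 ≤ ‖x - y‖ ^ 2 := by gcongr
  have h4 : j ^ 2 = |j| ^ 2 := (sq_abs j).symm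
  have hpos : 0 < ‖x - y‖ := lt_of_lt_of_le (by linarith) h2
  rw [slabWeight, div_le_div_iff₀ (by positivity) (by positivity)]
  nlinarith

/-- The potential of the squared kernel, for a bounded density carried by a thin set. -/
lemma potential_sq_le_slab {g : R3 → ℝ} (hg : Integrable g) (hg0 : ∀ y, 0 ≤ g y) {R : ℝ}
    (hR : 0 ≤ R) {a : ℤ → ℝ} (ha : ∀ k, 0 ≤ a k)
    (hga : ∀ᵐ y, g y ≤ R ∧ (0 < g y → rcyl y ≤ a ⌊y 2⌋)) {x : R3} (hx : 0 < rcyl x)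
    (hxa : rcyl x ≤ a ⌊x 2⌋) :
    ∫ y, g y / ‖x - y‖ ^ 2 ≤
      R * (radialConst + 8 * Real.pi) * (a (⌊x 2⌋ - 1) + a ⌊x 2⌋ + a (⌊x 2⌋ + 1)) +
        ∫ y, g y * slabWeight ⌊x 2⌋ y := by
  set k := ⌊x 2⌋ with hk
  set α := a (k - 1) + a k + a (k + 1) with hα
  have h0 := ha (k - 1)
  have h1 := ha k
  have h2 := ha (k + 1)
  have hα0 : 0 < α := by linarith
  have hT := integrable_truncKernel (β := 2) (by norm_num) hα0 x
  have hC := cylKernel_integrable hα0 (x 2)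
  have hW := integrable_mul_slabWeight hg hg0 k
  have := (integrable_and_integral_le (aestronglyMeasurable_div_norm_sq hg.1 x)
    (fun y => div_nonneg (hg0 y) (by positivity)) (((hT.add hC.1).const_mul R).add hW) (by
      filter_upwards [hga] with y hy
      simp only [Pi.add_apply]
      have hT0 := truncKernel_nonneg (β := 2) (h := α) (norm_nonneg (x - y))
      have hC0 := cylKernel_nonneg α (x 2) y
      have hW0 := mul_nonneg (hg0 y) (slabWeight_nonneg k y)
      rcases (hg0 y).eq_or_lt with hz | hpos
      · rw [← hz]
        simp only [zero_div, zero_mul, add_zero]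
        positivity
      by_cases hfar : 2 ≤ |⌊x 2⌋ - ⌊y 2⌋|
      · have h3 := mul_le_mul_of_nonneg_left (inv_dist_sq_le_slabWeight hfar) (hg0 y)
        rw [mul_one_div] at h3
        have : 0 ≤ R * (truncKernel 2 α ‖x - y‖ + cylKernel α (x 2) y) := by positivity
        linarith
      · have hyα : rcyl y ≤ α := by
          refine (hy.2 hpos).trans ?_
          have hn := abs_lt.1 (not_le.1 hfar)
          rw [← hk] at hn
          have : ⌊y 2⌋ = k - 1 ∨ ⌊y 2⌋ = k ∨ ⌊y 2⌋ = k + 1 := by omega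
          rcases this with e | e | e <;> rw [e] <;> linarith
        have h3 := inv_dist_sq_le_cyl (x := x) hα0 hyα
        have h4 : g y * (1 / ‖x - y‖ ^ 2) ≤ R * (truncKernel 2 α ‖x - y‖ + cylKernel α (x 2) y) :=
          mul_le_mul hy.1 h3 (by positivity) hR
        rw [mul_one_div] at h4
        linarith)).2
  refine this.trans_eq ?_
  rw [integral_add' ((hT.add hC.1).const_mul R) hW, integral_const_mul, integral_add' hT hC.1,
    integral_truncKernel (by norm_num) hα0 x, hC.2]
  have e : α ^ (3 - 2 : ℝ) / (3 - 2) = α := by norm_num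
  rw [e, radialConst]
  ring

lemma potential_sq_le_far {g : R3 → ℝ} (hg : Integrable g) (hg0 : ∀ y, 0 ≤ g y) {x : R3}
    (hx : ∀ y, 0 < g y → 2 ≤ |⌊x 2⌋ - ⌊y 2⌋|) :
    ∫ y, g y / ‖x - y‖ ^ 2 ≤ ∫ y, g y * slabWeight ⌊x 2⌋ y := by
  refine integral_mono_of_nonneg (Eventually.of_forall fun y => div_nonneg (hg0 y) (by positivity))
    (integrable_mul_slabWeight hg hg0 _) (Eventually.of_forall fun y => ?_)
  rcases (hg0 y).eq_or_lt with hz | hpos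
  · simp [← hz]
  · have h3 := mul_le_mul_of_nonneg_left (inv_dist_sq_le_slabWeight (hx y hpos)) (hg0 y)
    rwa [mul_one_div] at h3

lemma summable_inv_one_add_sq_int : Summable fun j : ℤ => 8 / (1 + (j : ℝ) ^ 2) := by
  have h := (Real.summable_one_div_int_pow (p := 2)).2 (by norm_num)
  have h' : Summable fun j : ℤ => (if j = 0 then (8 : ℝ) else 0) + 8 * (1 / (j : ℝ) ^ 2) :=
    (summable_of_ne_finset_zero (s := {0}) (by intro j hj; simp_all)).add (h.mul_left 8)
  refine Summable.of_nonneg_of_le (fun j => by positivity) (fun j => ?_) h'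
  split_ifs with hj
  · simp [hj]
  · have : (0 : ℝ) < (j : ℝ) ^ 2 := by positivity
    rw [zero_add, mul_one_div]
    gcongr
    linarith

/-- The total of the weights `slabWeight k y` over all `k`. -/
def slabConst : ℝ := ∑' j : ℤ, 8 / (1 + (j : ℝ) ^ 2)

lemma slabConst_nonneg : 0 ≤ slabConst := tsum_nonneg fun _ => by positivity

lemma sum_slabWeight_le (F : Finset ℤ) (y : R3) : ∑ k ∈ F, slabWeight k y ≤ slabConst := by
  have hs := (Equiv.subRight ⌊y 2⌋).summable_iff.2 summable_inv_one_add_sq_int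
  have e : slabConst = ∑' k : ℤ, 8 / (1 + (((k - ⌊y 2⌋ : ℤ)) : ℝ) ^ 2) :=
    ((Equiv.subRight ⌊y 2⌋).tsum_eq (fun j : ℤ => 8 / (1 + (j : ℝ) ^ 2))).symm
  rw [e]
  refine le_trans (le_of_eq ?_) (hs.sum_le_tsum F fun i _ => by
    simp only
    positivity)
  refine Finset.sum_congr rfl fun k _ => ?_
  simp [slabWeight]

lemma sum_integral_slabWeight_le {g : R3 → ℝ} (hg : Integrable g) (hg0 : ∀ y, 0 ≤ g y)
    (F : Finset ℤ) :
    ∑ k ∈ F, ∫ y, g y * slabWeight k y ≤ slabConst * ∫ y, g y := by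
  rw [← integral_finsetSum _ fun k _ => integrable_mul_slabWeight hg hg0 k, ← integral_const_mul]
  refine integral_mono (integrable_finsetSum _ fun k _ => integrable_mul_slabWeight hg hg0 k)
    (hg.const_mul _) fun y => ?_
  simp only
  rw [← Finset.mul_sum, mul_comm]
  exact mul_le_mul_of_nonneg_right (sum_slabWeight_le F y) (hg0 y)

lemma le_two_mul_of_le_half_succ {s : ℕ → ℝ} {H : ℝ}
    (h : ∀ N, s N ≤ 1 / 2 * s (N + 1) + H) (hs : ∀ N, s N ≤ 2 * N + 1) (N : ℕ) :
    s N ≤ 2 * H := by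
  have hit : ∀ n, s N - 2 * H ≤ (1 / 2) ^ n * (s (N + n) - 2 * H) := by
    intro n
    induction n with
    | zero => simp
    | succ n ih =>
      refine ih.trans ?_
      rw [pow_succ, mul_assoc]
      gcongr
      have := h (N + n)
      rw [← add_assoc]
      linarith
  have hit' : ∀ n : ℕ, s N - 2 * H ≤ 2 * ((n : ℝ) * (1 / 2) ^ n) + (2 * N + 1 - 2 * H) * (1 / 2) ^ n := by
    intro n
    refine (hit n).trans ?_
    have := hs (N + n)
    push_cast at this
    have hp : (0 : ℝ) ≤ (1 / 2) ^ n := by positivity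
    nlinarith
  have hlim : Tendsto (fun n : ℕ => 2 * ((n : ℝ) * (1 / 2) ^ n) + (2 * N + 1 - 2 * H) * (1 / 2) ^ n)
      atTop (𝓝 (2 * 0 + (2 * N + 1 - 2 * H) * 0)) :=
    ((tendsto_self_mul_const_pow_of_lt_one (by norm_num) (by norm_num)).const_mul 2).add
      ((tendsto_pow_atTop_nhds_zero_of_lt_one (by norm_num) (by norm_num)).const_mul _)
  have := ge_of_tendsto' hlim hit'
  linarith

/-- A sequence on `ℤ` that is controlled by a small multiple of its neighbours, up to a summable
error, is summable with a bound independent of its size. -/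
lemma sum_le_of_le_neighbours {a b : ℤ → ℝ} (ha : ∀ k, 0 ≤ a k) (ha1 : ∀ k, a k ≤ 1) {H : ℝ}
    (hb : ∀ F : Finset ℤ, ∑ k ∈ F, b k ≤ H)
    (h : ∀ k, a k ≤ 1 / 6 * (a (k - 1) + a k + a (k + 1)) + b k) (F : Finset ℤ) :
    ∑ k ∈ F, a k ≤ 2 * H := by
  let I : ℕ → Finset ℤ := fun N => Finset.Icc (-(N : ℤ)) N
  have hshift : ∀ (c : ℤ) (N : ℕ), |c| ≤ 1 → ∑ k ∈ I N, a (k + c) ≤ ∑ k ∈ I (N + 1), a k := by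
    intro c N hc
    rw [← Finset.sum_image (s := I N) (g := fun k => k + c) (f := a) (fun i _ j _ hij => by
      simpa using hij)]
    refine Finset.sum_le_sum_of_subset_of_nonneg ?_ fun i _ _ => ha i
    intro j hj
    have := abs_le.1 hc
    simp only [I, Finset.mem_image, Finset.mem_Icc] at hj ⊢
    push_cast
    omega
  have hN : ∀ N, ∑ k ∈ I N, a k ≤ 2 * H := by
    intro N
    refine le_two_mul_of_le_half_succ (s := fun N => ∑ k ∈ I N, a k) (fun N => ?_) (fun N => ?_) N
    · have h1 : ∑ k ∈ I N, a k ≤ ∑ k ∈ I N, (1 / 6 * (a (k + (-1)) + a (k + 0) + a (k + 1)) + b k) :=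
        Finset.sum_le_sum fun k _ => by simpa [sub_eq_add_neg] using h k
      rw [Finset.sum_add_distrib, ← Finset.mul_sum, Finset.sum_add_distrib,
        Finset.sum_add_distrib] at h1
      have h2 := hshift (-1) N (by norm_num)
      have h3 := hshift 0 N (by norm_num)
      have h4 := hshift 1 N (by norm_num)
      have h5 := hb (I N)
      linarith
    · refine (Finset.sum_le_sum fun k _ => ha1 k).trans (le_of_eq ?_)
      simp only [I, Finset.sum_const, Int.card_Icc, nsmul_eq_mul, mul_one]
      have : ((N : ℤ) + 1 - -(N : ℤ)).toNat = 2 * N + 1 := by omega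
      rw [this]
      push_cast
      ring
  obtain ⟨N, hFN⟩ : ∃ N, F ⊆ I N := by
    refine ⟨∑ k ∈ F, k.natAbs, fun k hk => ?_⟩
    have := Finset.single_le_sum (f := fun k : ℤ => k.natAbs) (fun _ _ => Nat.zero_le _) hk
    simp only [I, Finset.mem_Icc]
    omega
  exact (Finset.sum_le_sum_of_subset_of_nonneg hFN fun i _ _ => ha i).trans (hN N)

lemma F1.intervalIntegrable_div_sq {f : ℝ → ℝ} (hf1 : F1 f) (hf2 : F2 f) {s : ℝ} (hs : 0 < s) :
    IntervalIntegrable (fun t => f t / t ^ 2) volume 0 s := by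
  have hev : ∀ᶠ t in 𝓝[>] (0 : ℝ), f t / t ^ ((4 : ℝ) / 3) < 1 :=
    hf2.1.eventually (gt_mem_nhds one_pos)
  obtain ⟨δ, hδ, hδ'⟩ := mem_nhdsGT_iff_exists_Ioc_subset.1 hev
  have hδ0 : 0 < δ := hδ
  have hcont : ContinuousOn (fun t => f t / t ^ 2) (Ioi 0) :=
    hf1.2.1.div (by fun_prop) fun t ht => pow_ne_zero 2 (ne_of_gt ht)
  have h1 : IntervalIntegrable (fun t => f t / t ^ 2) volume 0 δ := by
    have hr : IntervalIntegrable (fun t : ℝ => t ^ (-(2 : ℝ) / 3)) volume 0 δ :=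
      intervalIntegral.intervalIntegrable_rpow' (by norm_num)
    rw [intervalIntegrable_iff_integrableOn_Ioc_of_le hδ0.le] at hr ⊢
    refine Integrable.mono' hr
      ((hcont.mono Ioc_subset_Ioi_self).aestronglyMeasurable measurableSet_Ioc) ?_
    filter_upwards [ae_restrict_mem measurableSet_Ioc] with t ht
    have ht0 : 0 < t := ht.1
    have hlt : f t / t ^ ((4 : ℝ) / 3) < 1 := hδ' ht
    have hf0 := hf1.1 t ht0
    rw [Real.norm_of_nonneg (by positivity), div_le_iff₀ (by positivity), ← Real.rpow_two,
      ← Real.rpow_add ht0]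
    rw [div_lt_one (by positivity)] at hlt
    norm_num
    exact hlt.le
  refine h1.trans (ContinuousOn.intervalIntegrable (hcont.mono ?_))
  intro t ht
  exact lt_of_lt_of_le (lt_min hδ0 hs) ht.1

lemma Aprime_mono {f : ℝ → ℝ} (hf1 : F1 f) (hf2 : F2 f) {s t : ℝ} (hs : 0 < s) (hst : s ≤ t) :
    Aprime f s ≤ Aprime f t := by
  have ht : 0 < t := hs.trans_le hst
  have hi := (hf1.intervalIntegrable_div_sq hf2 hs)
  have hi' := (hf1.intervalIntegrable_div_sq hf2 ht)
  have hst' := hi.symm.trans hi'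
  have h0 : (0 : ℝ) ∉ uIcc s t := by
    rw [uIcc_of_le hst]
    exact fun h => absurd h.1 (not_le.2 hs)
  have hz : ∫ u in s..t, u ^ (-2 : ℤ) = 1 / s - 1 / t := by
    rw [integral_zpow (Or.inr ⟨by norm_num, h0⟩)]
    norm_num
    ring
  have hzi : IntervalIntegrable (fun u : ℝ => u ^ (-2 : ℤ)) volume s t :=
    intervalIntegral.intervalIntegrable_zpow (Or.inr h0)
  have hle : f s * (1 / s - 1 / t) ≤ ∫ u in s..t, f u / u ^ 2 := by
    rw [← hz, ← intervalIntegral.integral_const_mul]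
    refine intervalIntegral.integral_mono_on hst (hzi.const_mul _) hst' fun u hu => ?_
    have hu0 : 0 < u := hs.trans_le hu.1
    have : f s ≤ f u := hf1.2.2.monotoneOn hs hu0 hu.1
    rw [zpow_neg, ← div_eq_mul_inv]
    norm_cast
    gcongr
  have hadd := intervalIntegral.integral_add_adjacent_intervals hi hst'
  have hfst : f s * (1 / t) ≤ f t * (1 / t) :=
    mul_le_mul_of_nonneg_right (hf1.2.2.monotoneOn hs ht hst) (by positivity)
  have e1 : f s / s = f s * (1 / s) := by ring
  have e2 : f t / t = f t * (1 / t) := by ring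
  rw [Aprime, Aprime, ← hadd, e1, e2]
  linarith

lemma div_le_Aprime {f : ℝ → ℝ} (hf1 : F1 f) {s : ℝ} (hs : 0 < s) : f s / s ≤ Aprime f s := by
  have : 0 ≤ ∫ t in (0 : ℝ)..s, f t / t ^ 2 := by
    refine intervalIntegral.integral_nonneg hs.le fun t ht => ?_
    rcases ht.1.eq_or_lt with h | h
    · simp [← h]
    · exact div_nonneg (hf1.1 t h) (by positivity)
  rw [Aprime]
  linarith

lemma eventually_le_of_liminf_pos {u : ℝ → ℝ} {l : Filter ℝ} (h : 0 < liminf u l) :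
    ∃ c, 0 < c ∧ ∀ᶠ s in l, c ≤ u s := by
  rw [liminf_eq] at h
  have hne : {a | ∀ᶠ s in l, a ≤ u s}.Nonempty := by
    by_contra hne
    rw [not_nonempty_iff_eq_empty.1 hne, Real.sSup_empty] at h
    exact lt_irrefl _ h
  obtain ⟨c, hc, hc0⟩ := exists_lt_of_lt_csSup hne h
  exact ⟨c, hc0, hc⟩

lemma exists_rpow_dominates {c e : ℝ} (hc : 0 < c) (he : 1 / 3 < e) {C₀ C₁ : ℝ} (hC₀ : 0 ≤ C₀) :
    ∀ᶠ R : ℝ in atTop, C₀ + C₁ * R ^ (1 / 3 : ℝ) < c * (R / 2) ^ e := by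
  have ht := tendsto_rpow_atTop (y := e - 1 / 3) (by linarith)
  filter_upwards [ht.eventually_gt_atTop ((C₀ + C₁) / (c * (1 / 2) ^ e)),
    eventually_ge_atTop 1] with R hR hR1
  have hR0 : 0 < R := by linarith
  have hpos : 0 < c * (1 / 2 : ℝ) ^ e := by positivity
  rw [div_lt_iff₀ hpos] at hR
  have h1 : 1 ≤ R ^ (1 / 3 : ℝ) := Real.one_le_rpow hR1 (by norm_num)
  have e1 : c * (R / 2) ^ e = (R ^ (e - 1 / 3) * (c * (1 / 2) ^ e)) * R ^ (1 / 3 : ℝ) := by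
    rw [show R ^ (e - 1 / 3) * (c * (1 / 2) ^ e) * R ^ (1 / 3 : ℝ)
      = c * ((R ^ (e - 1 / 3) * R ^ (1 / 3 : ℝ)) * (1 / 2) ^ e) by ring, ← Real.rpow_add hR0,
      sub_add_cancel, ← Real.mul_rpow hR0.le (by norm_num), mul_one_div]
  rw [e1]
  nlinarith

lemma horiz_apply (x : R3) : horiz x 0 = x 0 ∧ horiz x 1 = x 1 ∧ horiz x 2 = 0 := by
  simp [horiz]

lemma rcyl_add_smul_horiz (x : R3) {t : ℝ} (ht : 0 ≤ t) :
    rcyl (x + t • horiz x) = (1 + t) * rcyl x := by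
  obtain ⟨h0, h1, -⟩ := horiz_apply x
  rw [rcyl, rcyl]
  simp only [PiLp.add_apply, PiLp.smul_apply, smul_eq_mul, h0, h1]
  rw [show (x 0 + t * x 0) ^ 2 + (x 1 + t * x 1) ^ 2 = (1 + t) ^ 2 * (x 0 ^ 2 + x 1 ^ 2) by ring,
    Real.sqrt_mul (by positivity), Real.sqrt_sq (by positivity)]

lemma add_smul_horiz_two (x : R3) (t : ℝ) : (x + t • horiz x) 2 = x 2 := by
  simp [(horiz_apply x).2.2]

lemma norm_sub_add_smul_horiz (x : R3) {t : ℝ} (ht : 0 ≤ t) :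
    ‖x - (x + t • horiz x)‖ = t * rcyl x := by
  obtain ⟨h0, h1, h2⟩ := horiz_apply x
  have : ‖horiz x‖ = rcyl x := by
    rw [← sq_eq_sq₀ (norm_nonneg _) (rcyl_nonneg x), norm_sq_eq, rcyl_sq, h0, h1, h2]
    ring
  rw [sub_add_cancel_left, norm_neg, norm_smul, this, Real.norm_of_nonneg ht]

lemma volume_rcyl_eq_zero : volume {y : R3 | rcyl y = 0} = 0 := by
  have hsub : {y : R3 | rcyl y = 0} ⊆
      ⋃ k : ℤ, {y : R3 | rcyl y ≤ 0 ∧ (k : ℝ) ≤ y 2 ∧ y 2 ≤ (k : ℝ) + 1} := by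
    intro y hy
    exact mem_iUnion.2 ⟨⌊y 2⌋, le_of_eq hy, Int.floor_le _, (Int.lt_floor_add_one _).le⟩
  refine measure_mono_null hsub (measure_iUnion_null fun k => ?_)
  simpa using volume_slab_le 0 k

lemma ae_rcyl_pos : ∀ᵐ y : R3, 0 < rcyl y := by
  filter_upwards [compl_mem_ae_iff.2 volume_rcyl_eq_zero] with y hy
  exact (rcyl_nonneg y).lt_of_ne fun h => hy h.symm

/-- Bounded equilibria of mass `M` outside the core `K`, rotating with angular velocity `Ω`. -/
structure IsEquilibrium (f : ℝ → ℝ) (K : Set R3) (ρK : R3 → ℝ) (M Ω lam : ℝ) (ρ : R3 → ℝ) :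
    Prop where
  continuousOn : ContinuousOn ρ Kᶜ
  nonneg : ∀ x, 0 ≤ ρ x
  bounded : ∃ Cb : ℝ, ∀ x, ρ x ≤ Cb
  mass : ∫ x in Kᶜ, ρ x = M
  equation : ∀ x ∈ Kᶜ, 0 < ρ x →
    Aprime f (ρ x) - Bpot K ρ x - Jconst Ω x - BpotK K ρK x = lam

/-- The points off the axis where the fluid density is positive. -/
def fluidSet (K : Set R3) (ρ : R3 → ℝ) : Set R3 := {x | x ∈ Kᶜ ∧ 0 < ρ x ∧ 0 < rcyl x}

lemma Bpot_nonneg {K : Set R3} {ρ : R3 → ℝ} (hρ : ∀ x, 0 ≤ ρ x) (x : R3) : 0 ≤ Bpot K ρ x :=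
  integral_nonneg fun y => div_nonneg (hρ y) (norm_nonneg _)

lemma BpotK_nonneg {K : Set R3} {ρ : R3 → ℝ} (hρ : ∀ x, 0 ≤ ρ x) (x : R3) : 0 ≤ BpotK K ρ x :=
  integral_nonneg fun y => div_nonneg (hρ y) (norm_nonneg _)

lemma Bpot_eq_integral_indicator {K : Set R3} (hK : MeasurableSet K) (ρ : R3 → ℝ) (x : R3) :
    Bpot K ρ x = ∫ y, Kᶜ.indicator ρ y / ‖x - y‖ := by
  rw [Bpot, ← integral_indicator hK.compl]
  congr 1
  funext y
  by_cases hy : y ∈ Kᶜ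
  · rw [indicator_of_mem hy, indicator_of_mem hy]
  · rw [indicator_of_notMem hy, indicator_of_notMem hy, zero_div]

lemma BpotK_eq_integral {K : Set R3} {ρK : R3 → ℝ} (h : ∀ x ∉ K, ρK x = 0) (x : R3) :
    BpotK K ρK x = ∫ y, ρK y / ‖x - y‖ :=
  setIntegral_eq_integral_of_forall_compl_eq_zero fun y hy => by rw [h y hy, zero_div]

lemma integrable_of_rpow {K : Set R3} (hKo : MeasurableSet K) (hKb : Bornology.IsBounded K)
    {ρK : R3 → ℝ} {q : ℝ} (hq : 1 ≤ q) (h0 : ∀ x, 0 ≤ ρK x) (hsupp : ∀ x ∉ K, ρK x = 0)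
    (hint : Integrable fun x => ρK x ^ q) : Integrable ρK := by
  have hm : AEStronglyMeasurable ρK := by
    have h1 : AEMeasurable fun x => (ρK x ^ q) ^ q⁻¹ := hint.1.aemeasurable.pow_const _
    have e : (fun x => (ρK x ^ q) ^ q⁻¹) = ρK := by
      funext x
      exact Real.rpow_rpow_inv (h0 x) (by linarith)
    rw [e] at h1
    exact h1.aestronglyMeasurable
  have hK : Integrable (K.indicator (1 : R3 → ℝ)) :=
    (integrable_indicator_iff hKo).2 (by
      simpa [Pi.one_def] using hKb.measure_lt_top)
  refine (hK.add hint).mono' hm (Eventually.of_forall fun x => ?_)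
  rw [Real.norm_of_nonneg (h0 x), Pi.add_apply]
  by_cases hx : x ∈ K
  · rw [indicator_of_mem hx, Pi.one_apply]
    rcases le_total (ρK x) 1 with h | h
    · have := Real.rpow_nonneg (h0 x) q
      linarith
    · have := Real.rpow_le_rpow_of_exponent_le h hq
      rw [Real.rpow_one] at this
      linarith
  · rw [hsupp x hx, indicator_of_notMem hx, zero_add]
    positivity

lemma ae_mem_fluidSet (K : Set R3) (ρ : R3 → ℝ) :
    ∀ᵐ y, 0 < Kᶜ.indicator ρ y → y ∈ fluidSet K ρ ∧ Kᶜ.indicator ρ y = ρ y := by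
  filter_upwards [ae_rcyl_pos] with y hy hpos
  by_cases hyK : y ∈ Kᶜ
  · rw [indicator_of_mem hyK] at hpos ⊢
    exact ⟨⟨hyK, hpos, hy⟩, rfl⟩
  · rw [indicator_of_notMem hyK] at hpos
    exact absurd hpos (lt_irrefl _)

namespace IsEquilibrium

variable {f : ℝ → ℝ} {K : Set R3} {ρK : R3 → ℝ} {M Ω lam : ℝ} {ρ : R3 → ℝ}

/-- Moving away from the axis, the density takes every smaller positive value. -/
lemma exists_outward (h : IsEquilibrium f K ρK M Ω lam ρ) (hf1 : F1 f) (hf2 : F2 f)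
    (hK : NoTrapping K) (hρK : ∀ x, 0 ≤ ρK x) (hΩ : 0 < Ω) {x : R3} (hx : x ∈ fluidSet K ρ)
    {c : ℝ} (hc : 0 < c) (hcx : c < ρ x) :
    ∃ t : ℝ, 0 < t ∧ x + t • horiz x ∈ fluidSet K ρ ∧ ρ (x + t • horiz x) = c := by
  obtain ⟨hxK, hx0, hxr⟩ := hx
  have hmem : ∀ t : ℝ, 0 ≤ t → x + t • horiz x ∈ Kᶜ := fun t ht => hK x hxK t ht
  have hcontu : ContinuousOn (fun t : ℝ => ρ (x + t • horiz x)) (Ici 0) :=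
    h.continuousOn.comp (by fun_prop) fun t ht => hmem t ht
  suffices hex : ∃ t : ℝ, 0 < t ∧ ρ (x + t • horiz x) = c by
    obtain ⟨t, ht, hρt⟩ := hex
    refine ⟨t, ht, ⟨hmem t ht.le, hρt ▸ hc, ?_⟩, hρt⟩
    rw [rcyl_add_smul_horiz x ht.le]
    positivity
  by_contra hne
  push Not at hne
  have hgt : ∀ t : ℝ, 0 ≤ t → c < ρ (x + t • horiz x) := by
    intro t ht
    by_contra hle
    push Not at hle
    have hivt := intermediate_value_Icc' ht (hcontu.mono Icc_subset_Ici_self)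
    have hin : c ∈ Icc (ρ (x + t • horiz x)) (ρ (x + (0 : ℝ) • horiz x)) :=
      ⟨hle, by simpa using hcx.le⟩
    obtain ⟨t', ht', hρt'⟩ := hivt hin
    rcases ht'.1.eq_or_lt with h0 | h0
    · simp only [← h0, zero_smul, add_zero] at hρt'
      exact hcx.ne' hρt'
    · exact hne t' h0 hρt'
  obtain ⟨Cb, hCb⟩ := h.bounded
  have hJ : ∀ t : ℝ, 0 ≤ t → lam + (1 / 2) * Ω ^ 2 * ((1 + t) * rcyl x) ^ 2 ≤ Aprime f Cb := by
    intro t ht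
    have hpos := hc.trans (hgt t ht)
    have heq := h.equation _ (hmem t ht) hpos
    have h1 := Bpot_nonneg (K := K) h.nonneg (x + t • horiz x)
    have h2 := BpotK_nonneg (K := K) hρK (x + t • horiz x)
    have h3 := Aprime_mono hf1 hf2 hpos (hCb _)
    rw [Jconst, rcyl_add_smul_horiz x ht] at heq
    linarith
  set κ := (1 / 2) * Ω ^ 2 * rcyl x ^ 2 with hκ
  have hκ0 : 0 < κ := by positivity
  have := hJ (|Aprime f Cb - lam| / κ) (by positivity)
  have e : (1 / 2) * Ω ^ 2 * ((1 + |Aprime f Cb - lam| / κ) * rcyl x) ^ 2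
      = κ + 2 * |Aprime f Cb - lam| + |Aprime f Cb - lam| ^ 2 / κ := by
    rw [show (1 / 2) * Ω ^ 2 * ((1 + |Aprime f Cb - lam| / κ) * rcyl x) ^ 2
      = κ * (1 + |Aprime f Cb - lam| / κ) ^ 2 by rw [hκ]; ring]
    field_simp
    ring
  rw [e] at this
  have h1 : 0 ≤ |Aprime f Cb - lam| ^ 2 / κ := by positivity
  have h2 := le_abs_self (Aprime f Cb - lam)
  have h3 := abs_nonneg (Aprime f Cb - lam)
  linarith

lemma Aprime_le (h : IsEquilibrium f K ρK M Ω lam ρ) (hf1 : F1 f) (hf2 : F2 f)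
    (hK : NoTrapping K) (hρK : ∀ x, 0 ≤ ρK x) (hΩ : 0 < Ω) {x : R3} (hx : x ∈ fluidSet K ρ)
    (hx1 : 1 < ρ x) :
    Aprime f (ρ x) ≤ Aprime f 1 + Bpot K ρ x + BpotK K ρK x := by
  obtain ⟨t, ht, hmem, hρt⟩ := h.exists_outward hf1 hf2 hK hρK hΩ hx one_pos hx1
  have h1 := h.equation x hx.1 hx.2.1
  have h2 := h.equation _ hmem.1 hmem.2.1
  have h3 := Bpot_nonneg (K := K) h.nonneg (x + t • horiz x)
  have h4 := BpotK_nonneg (K := K) hρK (x + t • horiz x)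
  rw [hρt] at h2
  have h5 : Jconst Ω x ≤ Jconst Ω (x + t • horiz x) := by
    rw [Jconst, Jconst, rcyl_add_smul_horiz x ht.le]
    have := hx.2.2
    gcongr
    nlinarith
  linarith

lemma integrable_indicator (h : IsEquilibrium f K ρK M Ω lam ρ) (hK : MeasurableSet K)
    (hM : 0 < M) : Integrable (Kᶜ.indicator ρ) := by
  refine (integrable_indicator_iff hK.compl).2 ?_
  by_contra hni
  have := h.mass
  rw [integral_undef hni] at this
  exact hM.ne this

lemma integral_indicator (h : IsEquilibrium f K ρK M Ω lam ρ) (hK : MeasurableSet K) :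
    ∫ y, Kᶜ.indicator ρ y = M := by
  rw [MeasureTheory.integral_indicator hK.compl, h.mass]

lemma indicator_nonneg (h : IsEquilibrium f K ρK M Ω lam ρ) (y : R3) : 0 ≤ Kᶜ.indicator ρ y :=
  indicator_apply_nonneg fun _ => h.nonneg y

lemma ae_indicator_le (h : IsEquilibrium f K ρK M Ω lam ρ) {R : ℝ} (hR : 0 ≤ R)
    (hle : ∀ x ∈ fluidSet K ρ, ρ x ≤ R) : ∀ᵐ y, Kᶜ.indicator ρ y ≤ R := by
  filter_upwards [ae_mem_fluidSet K ρ] with y hy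
  rcases (h.indicator_nonneg y).eq_or_lt with h0 | h0
  · rwa [← h0]
  · rw [(hy h0).2]
    exact hle y (hy h0).1

/-- A bound on the density that does not depend on the angular velocity. -/
lemma density_le (h : IsEquilibrium f K ρK M Ω lam ρ) (hf1 : F1 f) (hf2 : F2 f)
    (hKm : MeasurableSet K) (hK : NoTrapping K) (hρK : ∀ x, 0 ≤ ρK x) (hM : 0 < M) (hΩ : 0 < Ω)
    {c γ s₁ CΦ R₀ : ℝ} (hγ : 1 < γ) (hc : 0 < c) (hfc : ∀ s, s₁ ≤ s → c ≤ f s / s ^ γ)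
    (hΦ : ∀ x, BpotK K ρK x ≤ CΦ) (hR₀ : 2 ≤ R₀) (hR₀s : 2 * s₁ ≤ R₀)
    (hdom : ∀ R, R₀ ≤ R →
      |Aprime f 1| + CΦ + (radialConst / 2 + M) * R ^ (1 / 3 : ℝ) < c * (R / 2) ^ (γ - 1)) :
    ∀ x ∈ fluidSet K ρ, ρ x ≤ R₀ := by
  obtain ⟨Cb, hCb⟩ := h.bounded
  by_contra hcon
  push Not at hcon
  obtain ⟨z, hz, hzR⟩ := hcon
  have hbdd : BddAbove (ρ '' fluidSet K ρ) := ⟨Cb, by rintro _ ⟨y, -, rfl⟩; exact hCb y⟩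
  set R := sSup (ρ '' fluidSet K ρ) with hR
  have hle : ∀ x ∈ fluidSet K ρ, ρ x ≤ R := fun x hx => le_csSup hbdd (mem_image_of_mem ρ hx)
  have hR₀R : R₀ < R := hzR.trans_le (hle z hz)
  have hRpos : 0 < R := by linarith
  obtain ⟨_, ⟨x, hx, rfl⟩, hxR⟩ := exists_lt_of_lt_csSup ⟨_, mem_image_of_mem ρ hz⟩
    (show R / 2 < sSup (ρ '' fluidSet K ρ) by rw [← hR]; linarith)
  have hx0 := hx.2.1
  have hA := h.Aprime_le hf1 hf2 hK hρK hΩ hx (by linarith)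
  have hlow : c * (R / 2) ^ (γ - 1) ≤ Aprime f (ρ x) := by
    refine le_trans ?_ (div_le_Aprime hf1 hx0)
    have h1 := hfc (ρ x) (by linarith)
    rw [le_div_iff₀ (by positivity)] at h1
    rw [le_div_iff₀ hx0]
    refine le_trans ?_ h1
    have e : ρ x ^ γ = ρ x ^ (γ - 1) * ρ x := by
      rw [← Real.rpow_add_one hx0.ne', sub_add_cancel]
    rw [e, ← mul_assoc]
    gcongr
  have hgR := h.ae_indicator_le hRpos.le hle
  have hpot := (potential_le (h.integrable_indicator hKm hM) h.indicator_nonneg hgR hRpos.le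
    (h := R ^ (-(1 / 3) : ℝ)) (by positivity) x).2
  rw [← Bpot_eq_integral_indicator hKm, h.integral_indicator hKm] at hpot
  have e1 : R * (radialConst * ((R ^ (-(1 / 3) : ℝ)) ^ 2 / 2)) + M / R ^ (-(1 / 3) : ℝ)
      = (radialConst / 2 + M) * R ^ (1 / 3 : ℝ) := by
    have e2 : R * (R ^ (-(1 / 3) : ℝ)) ^ 2 = R ^ (1 / 3 : ℝ) := by
      rw [← Real.rpow_natCast, ← Real.rpow_mul hRpos.le]
      nth_rewrite 1 [← Real.rpow_one R]
      rw [← Real.rpow_add hRpos]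
      norm_num
    rw [Real.rpow_neg hRpos.le, div_inv_eq_mul, ← Real.rpow_neg hRpos.le, add_mul, ← e2]
    ring
  rw [e1] at hpot
  have h1 := hdom R hR₀R.le
  have h2 := hΦ x
  have h3 := le_abs_self (Aprime f 1)
  linarith

/-- The distance to the axis is controlled by the potentials of the squared kernel at two points
of the fluid at the same height. -/
lemma rcyl_le (h : IsEquilibrium f K ρK M Ω lam ρ) (hf1 : F1 f) (hf2 : F2 f)
    (hKm : MeasurableSet K) (hK : NoTrapping K) (hρK : ∀ x, 0 ≤ ρK x)
    (hsupp : ∀ x ∉ K, ρK x = 0) (hΩ : 0 < Ω)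
    (hg1 : ∀ x, Integrable fun y => Kᶜ.indicator ρ y / ‖x - y‖)
    (hg2 : ∀ x, Integrable fun y => Kᶜ.indicator ρ y / ‖x - y‖ ^ 2)
    (hk1 : ∀ x, Integrable fun y => ρK y / ‖x - y‖)
    (hk2 : ∀ x, Integrable fun y => ρK y / ‖x - y‖ ^ 2)
    {x : R3} (hx : x ∈ fluidSet K ρ) {B : ℝ}
    (hB : ∀ x' ∈ fluidSet K ρ, x' 2 = x 2 →
      (∫ y, Kᶜ.indicator ρ y / ‖x' - y‖ ^ 2) + ∫ y, ρK y / ‖x' - y‖ ^ 2 ≤ B) :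
    rcyl x ≤ 2 / Ω ^ 2 * B := by
  have hx0 := hx.2.1
  obtain ⟨t, ht, hmem, hρt⟩ := h.exists_outward hf1 hf2 hK hρK hΩ hx (half_pos hx0)
    (half_lt_self hx0)
  have hA : Aprime f (ρ (x + t • horiz x)) ≤ Aprime f (ρ x) :=
    Aprime_mono hf1 hf2 hmem.2.1 (by rw [hρt]; linarith)
  have h1 := h.equation x hx.1 hx.2.1
  have h2 := h.equation _ hmem.1 hmem.2.1
  have b1 := hB x hx rfl
  have b2 := hB _ hmem (add_smul_horiz_two x t)
  have hd := norm_sub_add_smul_horiz x ht.le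
  have p1 := potential_sub_le h.indicator_nonneg (hg1 x) (hg1 (x + t • horiz x)) (hg2 x)
    (hg2 (x + t • horiz x))
  have p2 := potential_sub_le hρK (hk1 x) (hk1 (x + t • horiz x)) (hk2 x)
    (hk2 (x + t • horiz x))
  rw [hd] at p1 p2
  rw [← Bpot_eq_integral_indicator hKm, ← Bpot_eq_integral_indicator hKm] at p1
  rw [← BpotK_eq_integral hsupp, ← BpotK_eq_integral hsupp] at p2
  rw [Jconst] at h1 h2
  rw [rcyl_add_smul_horiz x ht.le] at h2
  set r := rcyl x
  have hr : 0 < r := hx.2.2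
  have htr : 0 < t * r := mul_pos ht hr
  have hkey : (1 / 2) * Ω ^ 2 * ((1 + t) * r) ^ 2 - (1 / 2) * Ω ^ 2 * r ^ 2 ≤ t * r / 2 * (2 * B) := by
    have := mul_le_mul_of_nonneg_left (add_le_add b1 b2) (half_pos htr).le
    linarith
  have hkey' : (t * r) * (Ω ^ 2 * r) ≤ (t * r) * B := by
    have e : (1 / 2) * Ω ^ 2 * ((1 + t) * r) ^ 2 - (1 / 2) * Ω ^ 2 * r ^ 2
        = (t * r) * (Ω ^ 2 * r) + (1 / 2) * Ω ^ 2 * (t * r) ^ 2 := by ring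
    have : 0 ≤ (1 / 2) * Ω ^ 2 * (t * r) ^ 2 := by positivity
    linarith
  have hfin := le_of_mul_le_mul_left hkey' htr
  have hB0 : 0 ≤ B := le_trans (by positivity) hfin
  rw [div_mul_eq_mul_div, le_div_iff₀ (by positivity)]
  linarith

/-- The mass is at most the maximal density times the volume of the slabs carrying the fluid. -/
lemma mass_le (h : IsEquilibrium f K ρK M Ω lam ρ) (hKm : MeasurableSet K) (hM : 0 < M)
    {R : ℝ} (hR : 0 ≤ R) (hle : ∀ x ∈ fluidSet K ρ, ρ x ≤ R) {a : ℤ → ℝ} (ha : ∀ k, 0 ≤ a k)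
    (ha1 : ∀ k, a k ≤ 1) (hra : ∀ x ∈ fluidSet K ρ, rcyl x ≤ a ⌊x 2⌋) {S : ℝ}
    (hS : ∀ F : Finset ℤ, ∑ k ∈ F, a k ≤ S) : M ≤ 4 * R * S := by
  have hS0 : 0 ≤ S := by simpa using hS ∅
  let slab : ℤ → Set R3 := fun k => {y | rcyl y ≤ a k ∧ (k : ℝ) ≤ y 2 ∧ y 2 ≤ (k : ℝ) + 1}
  have hvol : volume (⋃ k, slab k) ≤ ENNReal.ofReal (4 * S) := by
    refine (measure_iUnion_le slab).trans ?_
    rw [ENNReal.tsum_eq_iSup_sum]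
    refine iSup_le fun F => ?_
    have hk : ∀ k ∈ F, volume (slab k) ≤ ENNReal.ofReal (4 * a k) := by
      intro k _
      refine (volume_slab_le (a k) k).trans ?_
      rw [← ENNReal.ofReal_pow (by linarith [ha k])]
      exact ENNReal.ofReal_le_ofReal (by nlinarith [ha k, ha1 k])
    refine (Finset.sum_le_sum hk).trans ?_
    rw [← ENNReal.ofReal_sum_of_nonneg fun k _ => by linarith [ha k], ← Finset.mul_sum]
    exact ENNReal.ofReal_le_ofReal (by linarith [hS F])
  have hmass : ENNReal.ofReal M ≤ ENNReal.ofReal R * volume (⋃ k, slab k) := by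
    rw [← h.integral_indicator hKm, ofReal_integral_eq_lintegral_ofReal
      (h.integrable_indicator hKm hM) (Eventually.of_forall h.indicator_nonneg)]
    refine le_trans (lintegral_mono_ae ?_) (lintegral_indicator_const_le (⋃ k, slab k) _)
    filter_upwards [ae_mem_fluidSet K ρ] with y hy
    rcases (h.indicator_nonneg y).eq_or_lt with h0 | h0
    · rw [← h0, ENNReal.ofReal_zero]
      exact zero_le
    · obtain ⟨hyT, hye⟩ := hy h0
      rw [hye, indicator_of_mem]
      · exact ENNReal.ofReal_le_ofReal (hle y hyT)
      · exact mem_iUnion.2 ⟨⌊y 2⌋, hra y hyT, Int.floor_le _, (Int.lt_floor_add_one _).le⟩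
  have := hmass.trans (mul_le_mul_right hvol _)
  rw [← ENNReal.ofReal_mul hR, ENNReal.ofReal_le_ofReal_iff (by positivity)] at this
  linarith

end IsEquilibrium

/-- **Theorem 2.5.** Non-existence of rotating planet solutions for sufficiently
fast constant rotation, when the core potential is the Newtonian potential of a
fixed core density `ρ_K ∈ L^q(K)`, `q > 3`. -/
theorem nonexistence_fast_rotation
    (f : ℝ → ℝ) (hf1 : F1 f) (hf2 : F2 f)
    (hf3 : ∃ γ : ℝ, γ > 4/3 ∧ 0 < Filter.liminf (fun s => f s / s ^ γ) atTop)
    (f' : ℝ → ℝ) (hf'd : ∀ s : ℝ, 0 < s → HasDerivAt f (f' s) s)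
    (hf'c : ContinuousOn f' (Ioi 0))
    (hf4 : ∃ μ : ℝ, μ > 0 ∧
      0 < Filter.liminf (fun s => f' s / s ^ μ) (nhdsWithin 0 (Ioi 0)))
    (K : Set R3) (hKo : IsOpen K) (hKb : Bornology.IsBounded K) (hKa : AxisymmetricSet K)
    (hKnt : NoTrapping K)
    (q : ℝ) (hq : q > 3)
    (ρK : R3 → ℝ) (hρK0 : ∀ x, 0 ≤ ρK x) (hρKa : AxisymmetricFun ρK)
    (hρKsupp : ∀ x ∉ K, ρK x = 0) (hρKq : Integrable (fun x => ρK x ^ q))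
    (M : ℝ) (hM : 0 < M) :
    ∃ Ω₀ > 0, ∀ Ω : ℝ, Ω > Ω₀ →
      ¬ ∃ (ρ : R3 → ℝ) (lam : ℝ),
        ContinuousOn ρ Kᶜ ∧ (∀ x, 0 ≤ ρ x) ∧ (∃ Cb : ℝ, ∀ x, ρ x ≤ Cb) ∧
        (∫ x in Kᶜ, ρ x) = M ∧
        ∀ x ∈ Kᶜ, 0 < ρ x →
          Aprime f (ρ x) - Bpot K ρ x - Jconst Ω x - BpotK K ρK x = lam := by
  obtain ⟨γ, hγ, hlim⟩ := hf3
  obtain ⟨c, hc, hev⟩ := eventually_le_of_liminf_pos hlim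
  obtain ⟨s₁, hs₁⟩ := eventually_atTop.1 hev
  have hKm : MeasurableSet K := hKo.measurableSet
  have hρKi : Integrable ρK := integrable_of_rpow hKm hKb (by linarith) hρK0 hρKsupp hρKq
  obtain ⟨CK, hCK0, hCK⟩ := potential_sq_le_of_rpow hρKi hρK0 hq hρKq
  set MK := ∫ y, ρK y with hMK
  have hMK0 : 0 ≤ MK := integral_nonneg hρK0
  have hk1 : ∀ x, Integrable (fun y => ρK y / ‖x - y‖) ∧ ∫ y, ρK y / ‖x - y‖ ≤ MK + CK := fun x =>
    have := potential_le_of_sq hρKi hρK0 x (hCK x).1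
    ⟨this.1, this.2.trans (add_le_add_right (hCK x).2 _)⟩
  have hΦ : ∀ x, BpotK K ρK x ≤ MK + CK := fun x => by
    rw [BpotK_eq_integral hρKsupp]
    exact (hk1 x).2
  obtain ⟨R₁, hR₁⟩ := eventually_atTop.1 (exists_rpow_dominates (C₁ := radialConst / 2 + M) hc
    (show 1 / 3 < γ - 1 by linarith) (show 0 ≤ |Aprime f 1| + (MK + CK) by positivity))
  set R₀ := max R₁ (max 2 (2 * s₁)) with hR₀
  have hR₀2 : 2 ≤ R₀ := le_max_of_le_right (le_max_left _ _)
  have hR₀s : 2 * s₁ ≤ R₀ := le_max_of_le_right (le_max_right _ _)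
  have hR₀0 : 0 ≤ R₀ := by linarith
  obtain ⟨BK, hBK⟩ := hKb.exists_norm_le
  obtain ⟨Z, hZ⟩ := exists_nat_gt (BK + 3)
  have hfar : ∀ x : R3, (Z : ℤ) < |⌊x 2⌋| → ∀ y, 0 < ρK y → 2 ≤ |⌊x 2⌋ - ⌊y 2⌋| := by
    intro x hx y hy
    have hyK : y ∈ K := by
      by_contra hyK
      exact hy.ne' (hρKsupp y hyK)
    have h1 := abs_le.1 ((abs_coord_le_norm y 2).trans (hBK y hyK))
    have h2 : ⌊y 2⌋ < (Z : ℤ) - 2 := Int.floor_lt.2 (by push_cast; linarith)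
    have h3 : -((Z : ℤ) - 2) ≤ ⌊y 2⌋ := Int.le_floor.2 (by push_cast; linarith)
    rcases abs_cases ⌊x 2⌋ with ⟨e, -⟩ | ⟨e, -⟩
    · exact le_trans (by omega) (le_abs_self _)
    · exact le_trans (by omega) (neg_le_abs _)
  have hrc := radialConst_nonneg
  have hsc := slabConst_nonneg
  have hpi := Real.pi_pos
  set W := R₀ * radialConst + M + CK with hW
  set C := R₀ * (radialConst + 8 * Real.pi) with hC
  set H := slabConst * (M + MK) + (2 * Z + 1) * CK with hH
  have hW0 : 0 ≤ W := by positivity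
  have hC0 : 0 ≤ C := by positivity
  have hH0 : 0 ≤ H := by positivity
  refine ⟨1 + 12 * C + 2 * W + 16 * R₀ * H / M, by positivity, ?_⟩
  rintro Ω hΩ ⟨ρ, lam, hcont, hρ0, hbdd, hmass, heq⟩
  have hE : IsEquilibrium f K ρK M Ω lam ρ := ⟨hcont, hρ0, hbdd, hmass, heq⟩
  have hRHM : 0 ≤ 16 * R₀ * H / M := by positivity
  have hΩ1 : 1 < Ω := by linarith
  have hΩ0 : 0 < Ω := by linarith
  have hΩsq : 1 + 12 * C + 2 * W + 16 * R₀ * H / M < Ω ^ 2 := by nlinarith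
  have hρR := hE.density_le hf1 hf2 hKm hKnt hρK0 hM hΩ0 (by linarith) hc hs₁ hΦ hR₀2 hR₀s
    (fun R hR => hR₁ R ((le_max_left _ _).trans hR))
  have hgi := hE.integrable_indicator hKm hM
  have hgR := hE.ae_indicator_le hR₀0 hρR
  have hgM := hE.integral_indicator hKm
  have hg1 := fun x => (potential_le hgi hE.indicator_nonneg hgR hR₀0 one_pos x).1
  have hg2 := fun x => potential_sq_le hgi hE.indicator_nonneg hgR hR₀0 x
  rw [hgM] at hg2
  have hrad := fun x (hx : x ∈ fluidSet K ρ) (B : ℝ) => hE.rcyl_le hf1 hf2 hKm hKnt hρK0 hρKsupp hΩ0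
    hg1 (fun x => (hg2 x).1) (fun x => (hk1 x).1) (fun x => (hCK x).1) hx (B := B)
  have hr1 : ∀ x ∈ fluidSet K ρ, rcyl x ≤ 1 := fun x hx => by
    refine (hrad x hx W fun x' _ _ => add_le_add (hg2 x').2 (hCK x').2).trans ?_
    rw [div_mul_eq_mul_div, div_le_one (by positivity)]
    linarith
  let a : ℤ → ℝ := fun k => sSup (rcyl '' {x | x ∈ fluidSet K ρ ∧ ⌊x 2⌋ = k})
  have ha0 : ∀ k, 0 ≤ a k := fun k => Real.sSup_nonneg (by rintro _ ⟨x, -, rfl⟩; exact rcyl_nonneg x)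
  have ha1 : ∀ k, a k ≤ 1 := fun k =>
    Real.sSup_le (by rintro _ ⟨x, hx, rfl⟩; exact hr1 x hx.1) zero_le_one
  have hra : ∀ x ∈ fluidSet K ρ, rcyl x ≤ a ⌊x 2⌋ := fun x hx =>
    le_csSup ⟨1, by rintro _ ⟨y, hy, rfl⟩; exact hr1 y hy.1⟩ (mem_image_of_mem _ ⟨hx, rfl⟩)
  have hga : ∀ᵐ y, Kᶜ.indicator ρ y ≤ R₀ ∧ (0 < Kᶜ.indicator ρ y → rcyl y ≤ a ⌊y 2⌋) := by
    filter_upwards [hgR, ae_mem_fluidSet K ρ] with y hy hy'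
    exact ⟨hy, fun h0 => hra y (hy' h0).1⟩
  let τ : ℤ → ℝ := fun k => (∫ y, Kᶜ.indicator ρ y * slabWeight k y) + (∫ y, ρK y * slabWeight k y) +
    if |k| ≤ (Z : ℤ) then CK else 0
  have hw : ∀ k, 0 ≤ ∫ y, ρK y * slabWeight k y := fun k =>
    integral_nonneg fun y => mul_nonneg (hρK0 y) (slabWeight_nonneg k y)
  have hw' : ∀ k, 0 ≤ ∫ y, Kᶜ.indicator ρ y * slabWeight k y := fun k =>
    integral_nonneg fun y => mul_nonneg (hE.indicator_nonneg y) (slabWeight_nonneg k y)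
  have hτ0 : ∀ k, 0 ≤ τ k := fun k => by
    have h1 := hw k
    have h2 := hw' k
    simp only [τ]
    positivity
  have hQ : ∀ x ∈ fluidSet K ρ, (∫ y, Kᶜ.indicator ρ y / ‖x - y‖ ^ 2) + ∫ y, ρK y / ‖x - y‖ ^ 2 ≤
      C * (a (⌊x 2⌋ - 1) + a ⌊x 2⌋ + a (⌊x 2⌋ + 1)) + τ ⌊x 2⌋ := by
    intro x hx
    have h1 := potential_sq_le_slab hgi hE.indicator_nonneg hR₀0 ha0 hga hx.2.2 (hra x hx)
    have h2 : ∫ y, ρK y / ‖x - y‖ ^ 2 ≤ (∫ y, ρK y * slabWeight ⌊x 2⌋ y) +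
        if |⌊x 2⌋| ≤ (Z : ℤ) then CK else 0 := by
      split_ifs with hnear
      · linarith [(hCK x).2, hw ⌊x 2⌋]
      · rw [add_zero]
        exact potential_sq_le_far hρKi hρK0 (hfar x (not_le.1 hnear))
    simp only [τ]
    linarith
  have hak : ∀ k, a k ≤ 1 / 6 * (a (k - 1) + a k + a (k + 1)) + 2 / Ω ^ 2 * τ k := by
    intro k
    have hsum : 0 ≤ a (k - 1) + a k + a (k + 1) := by linarith [ha0 (k - 1), ha0 k, ha0 (k + 1)]
    have hτk := hτ0 k
    refine Real.sSup_le ?_ (by positivity)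
    rintro _ ⟨x, ⟨hx, rfl⟩, rfl⟩
    refine (hrad x hx (C * (a (⌊x 2⌋ - 1) + a ⌊x 2⌋ + a (⌊x 2⌋ + 1)) + τ ⌊x 2⌋)
      fun x' hx' hxx' => ?_).trans ?_
    · have := hQ x' hx'
      rwa [hxx'] at this
    · rw [mul_add, ← mul_assoc]
      gcongr
      rw [div_mul_eq_mul_div, div_le_div_iff₀ (by positivity) (by norm_num)]
      linarith
  have hτs : ∀ F : Finset ℤ, ∑ k ∈ F, 2 / Ω ^ 2 * τ k ≤ 2 / Ω ^ 2 * H := by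
    intro F
    rw [← Finset.mul_sum]
    gcongr
    simp only [τ]
    rw [Finset.sum_add_distrib, Finset.sum_add_distrib]
    have h1 := sum_integral_slabWeight_le hgi hE.indicator_nonneg F
    have h2 := sum_integral_slabWeight_le hρKi hρK0 F
    rw [hgM] at h1
    have h3 : ∑ k ∈ F, (if |k| ≤ (Z : ℤ) then CK else 0) ≤ (2 * Z + 1) * CK := by
      rw [← Finset.sum_filter, Finset.sum_const, nsmul_eq_mul]
      gcongr
      have hsub : F.filter (fun k : ℤ => |k| ≤ (Z : ℤ)) ⊆ Finset.Icc (-(Z : ℤ)) Z := by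
        intro k hk
        rw [Finset.mem_Icc]
        exact abs_le.1 (Finset.mem_filter.1 hk).2
      have hcard := Finset.card_le_card hsub
      rw [Int.card_Icc] at hcard
      have : (F.filter (fun k : ℤ => |k| ≤ (Z : ℤ))).card ≤ 2 * Z + 1 := by omega
      exact_mod_cast this
    rw [hH]
    linarith
  have hfinal := hE.mass_le hKm hM hR₀0 hρR ha0 ha1 hra (sum_le_of_le_neighbours ha0 ha1 hτs hak)
  have e : 4 * R₀ * (2 * (2 / Ω ^ 2 * H)) = 16 * R₀ * H / Ω ^ 2 := by ring
  rw [e, le_div_iff₀ (by positivity)] at hfinal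
  have : 16 * R₀ * H < M * Ω ^ 2 := by
    have h1 : 16 * R₀ * H / M < Ω ^ 2 := by linarith
    rw [div_lt_iff₀ hM] at h1
    linarith
  linarith
end
end

section
/- There is an absolute constant c > 0 with the following property: if ρ ∈ L¹(ℝ³) is nonnegative and axisymmetric with ∫_{ℝ³} ρ = M, and x ∈ ℝ³ satisfies r(x) := √(x₁²+x₂²) ≥ 2 and ∫_{|y−x|<1} ρ(y) dy ≥ ε for some ε > 0, then r(x) ≤ cM/ε. -/
open MeasureTheory Filter Set Topology

noncomputable section

/-- Rotation about the `x₃`-axis as a linear isometry. -/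
def rotLinearIsometry (θ : ℝ) : R3 →ₗᵢ[ℝ] R3 where
  toFun := rot θ
  map_add' x y := by
    ext i
    fin_cases i <;> simp [rot] <;> ring
  map_smul' a x := by
    ext i
    fin_cases i <;> simp [rot] <;> ring
  norm_map' x := by
    simp only [LinearMap.coe_mk, AddHom.coe_mk, EuclideanSpace.norm_eq]
    congr 1
    simp only [rot, Fin.sum_univ_three, Real.norm_eq_abs, sq_abs]
    simp
    linear_combination (x 0 ^ 2 + x 1 ^ 2) * Real.sin_sq_add_cos_sq θ

/-- Rotation about the `x₃`-axis as a linear isometric equivalence. -/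
def rotLinearIsometryEquiv (θ : ℝ) : R3 ≃ₗᵢ[ℝ] R3 :=
  (rotLinearIsometry θ).toLinearIsometryEquiv rfl

theorem rotLinearIsometryEquiv_apply (θ : ℝ) (x : R3) :
    rotLinearIsometryEquiv θ x = rot θ x := rfl

theorem AxisymmetricFun.setIntegral_ball_rot {ρ : R3 → ℝ} (h : AxisymmetricFun ρ)
    (θ : ℝ) (x : R3) (s : ℝ) :
    ∫ y in Metric.ball (rot θ x) s, ρ y = ∫ y in Metric.ball x s, ρ y := by
  have key := (rotLinearIsometryEquiv θ).measurePreserving.setIntegral_preimage_emb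
    (rotLinearIsometryEquiv θ).toHomeomorph.measurableEmbedding ρ (Metric.ball (rot θ x) s)
  rw [← rotLinearIsometryEquiv_apply θ x, (rotLinearIsometryEquiv θ).isometry.preimage_ball]
    at key
  simp only [rotLinearIsometryEquiv_apply, h θ] at key
  exact key.symm

theorem dist_rot_rot (a b : ℝ) (x : R3) :
    dist (rot a x) (rot b x) = 2 * rcyl x * |Real.sin ((a - b) / 2)| := by
  have h : Real.cos (a - b) = 1 - 2 * Real.sin ((a - b) / 2) ^ 2 := by
    have := Real.cos_two_mul ((a - b) / 2)
    rw [Real.cos_sq', mul_div_cancel₀ _ (two_ne_zero' ℝ)] at this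
    linarith
  rw [Real.cos_sub] at h
  have hr : rcyl x ^ 2 = x 0 ^ 2 + x 1 ^ 2 := Real.sq_sqrt (by positivity)
  have hnn : 0 ≤ rcyl x := Real.sqrt_nonneg _
  rw [EuclideanSpace.dist_eq, ← Real.sqrt_sq (by positivity : 0 ≤ 2 * rcyl x * _), mul_pow,
    mul_pow, sq_abs, hr]
  congr 1
  simp only [Fin.sum_univ_three, Real.dist_eq, sq_abs]
  simp [rot]
  linear_combination (x 0 ^ 2 + x 1 ^ 2) *
    (Real.sin_sq_add_cos_sq a + Real.sin_sq_add_cos_sq b - 2 * h)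

theorem two_le_dist_rot_rot {x : R3} (hx : 0 < rcyl x) {i j : ℕ} (hij : i < j)
    (hj : (j : ℝ) ≤ rcyl x) :
    2 ≤ dist (rot (j * (Real.pi / rcyl x)) x) (rot (i * (Real.pi / rcyl x)) x) := by
  have hd : (1 : ℝ) ≤ (j : ℝ) - i := by
    have : (i : ℝ) + 1 ≤ j := by exact_mod_cast hij
    linarith
  have hi : (0 : ℝ) ≤ i := i.cast_nonneg
  have hπ := Real.pi_pos
  have e : (j * (Real.pi / rcyl x) - i * (Real.pi / rcyl x)) / 2
      = (((j : ℝ) - i) / rcyl x) * (Real.pi / 2) := by ring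
  have ht : ((j : ℝ) - i) / rcyl x ≤ 1 := (div_le_one hx).2 (by linarith)
  have hs := Real.mul_le_sin
    (x := (((j : ℝ) - i) / rcyl x) * (Real.pi / 2)) (by positivity) (by nlinarith)
  have e2 : 2 / Real.pi * ((((j : ℝ) - i) / rcyl x) * (Real.pi / 2))
      = ((j : ℝ) - i) / rcyl x := by field_simp
  rw [e2] at hs
  rw [dist_rot_rot, e]
  calc (2 : ℝ) ≤ 2 * ((j : ℝ) - i) := by linarith
    _ = 2 * rcyl x * (((j : ℝ) - i) / rcyl x) := by field_simp
    _ ≤ _ := by gcongr; exact hs.trans (le_abs_self _)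

/-- **Lemma 4.5.** If an axisymmetric nonnegative density of total mass `M` has mass
at least `ε` in some unit ball centered at `x` with `r(x) ≥ 2`, then
`r(x) ≤ cM/ε` for an absolute constant `c`. -/
theorem mass_in_unit_ball_bounds_radius :
    ∃ c > 0, ∀ (M ε : ℝ) (ρ : R3 → ℝ) (x : R3),
      0 < ε → Integrable ρ → (∀ y, 0 ≤ ρ y) → AxisymmetricFun ρ →
      (∫ y, ρ y) = M → 2 ≤ rcyl x →
      ε ≤ (∫ y in Metric.ball x 1, ρ y) →
      rcyl x ≤ c * M / ε := by
  refine ⟨1, one_pos, fun M ε ρ x hε hint hnn hax hM hr hball => ?_⟩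
  have hx : 0 < rcyl x := by linarith
  set c : ℕ → R3 := fun k => rot (k * (Real.pi / rcyl x)) x with hc
  set s := Finset.range (⌊rcyl x⌋₊ + 1) with hs
  have hsep : ∀ i j : ℕ, j ∈ s → i < j →
      Disjoint (Metric.ball (c i) 1) (Metric.ball (c j) 1) := by
    intro i j hj hij
    have hj' : (j : ℝ) ≤ rcyl x :=
      (Nat.le_floor_iff hx.le).1 (Nat.lt_succ_iff.1 (Finset.mem_range.1 hj))
    apply Metric.ball_disjoint_ball
    rw [dist_comm]
    linarith [two_le_dist_rot_rot hx hij hj']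
  have hdisj : (s : Set ℕ).Pairwise (Function.onFun Disjoint fun k => Metric.ball (c k) 1) := by
    intro i hi j hj hij
    rcases hij.lt_or_gt with h | h
    · exact hsep i j hj h
    · exact (hsep j i hi h).symm
  have hsum : ((⌊rcyl x⌋₊ : ℝ) + 1) * ε ≤ M := by
    calc ((⌊rcyl x⌋₊ : ℝ) + 1) * ε = ∑ _k ∈ s, ε := by simp [hs]
      _ ≤ ∑ k ∈ s, ∫ y in Metric.ball (c k) 1, ρ y :=
        Finset.sum_le_sum fun k _ => by rwa [hc, hax.setIntegral_ball_rot]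
      _ = ∫ y in ⋃ k ∈ s, Metric.ball (c k) 1, ρ y :=
        (integral_biUnion_finset s (fun _ _ => measurableSet_ball) hdisj
          fun _ _ => hint.integrableOn).symm
      _ ≤ ∫ y, ρ y := setIntegral_le_integral hint (Eventually.of_forall hnn)
      _ = M := hM
  rw [one_mul, le_div_iff₀ hε]
  exact (mul_le_mul_of_nonneg_right (Nat.lt_floor_add_one _).le hε.le).trans hsum
end
end

section
/- Let ρ ∈ L¹(ℝ³) ∩ L^∞(ℝ³) be nonnegative and supported in the infinite cylinder {x₁² + x₂² ≤ d²}. Then there is an absolute constant C > 0 such that for every x with x₁² + x₂² ≤ d², the directional derivative of Bρ at x in the cylindrical radial direction satisfies |(Bρ)_r(x)| ≤ C ‖ρ‖_∞ (d + √(x₁²+x₂²)). -/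
open MeasureTheory Filter Set Topology

noncomputable section

/-- The Newtonian potential `Bρ(x) = ∫ ρ(y)/|x-y| dy` over all of `ℝ³`. -/
def Bfull (ρ : R3 → ℝ) (x : R3) : ℝ := ∫ y, ρ y / ‖x - y‖

/-- The unit vector in the cylindrical radial direction at `x`
(the zero vector on the axis). -/
def radialDir (x : R3) : R3 :=
  (rcyl x)⁻¹ • (EuclideanSpace.equiv (Fin 3) ℝ).symm ![x 0, x 1, 0]

/-- The profile `s ^ (-2/3)` near the origin and `s ^ (-2)` at infinity. -/
def decayProfile (s : ℝ) : ℝ := if s ≤ 1 then s ^ (-(2 / 3) : ℝ) else s ^ (-2 : ℝ)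

lemma integrable_decayProfile_abs : Integrable (fun s : ℝ => decayProfile |s|) := by
  have h := integrable_fun_norm_addHaar (volume : Measure ℝ) (f := decayProfile)
  simp only [Module.finrank_self, Real.norm_eq_abs] at h
  rw [h]
  simp only [le_refl, tsub_eq_zero_of_le, pow_zero, one_smul]
  rw [← Ioc_union_Ioi_eq_Ioi (zero_le_one (α := ℝ))]
  refine IntegrableOn.union ?_ ?_
  · have h1 := intervalIntegral.intervalIntegrable_rpow' (a := 0) (b := 1)
      (r := (-(2 / 3) : ℝ)) (by norm_num)
    rw [intervalIntegrable_iff_integrableOn_Ioc_of_le zero_le_one] at h1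
    refine h1.congr_fun (fun s hs => ?_) measurableSet_Ioc
    simp [decayProfile, hs.2]
  · refine (integrableOn_Ioi_rpow_of_lt (a := -2) (by norm_num) one_pos).congr_fun
      (fun s hs => ?_) measurableSet_Ioi
    simp [decayProfile, not_le.2 (mem_Ioi.1 hs)]

lemma decayProfile_nonneg {s : ℝ} (hs : 0 ≤ s) : 0 ≤ decayProfile s := by
  unfold decayProfile
  split_ifs <;> positivity

lemma one_le_decayProfile {s : ℝ} (hs : 0 < s) (hs1 : s ≤ 1) : 1 ≤ decayProfile s := by
  rw [decayProfile, if_pos hs1]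
  exact Real.one_le_rpow_of_pos_of_le_one_of_nonpos hs hs1 (by norm_num)

lemma inv_sq_le_decayProfile_prod {a b c M : ℝ} (ha : 0 < a) (hb : 0 < b) (hc : 0 < c)
    (ha1 : a ≤ 1) (hb1 : b ≤ 1) (haM : a ≤ M) (hbM : b ≤ M) (hcM : c ≤ M) :
    (M ^ 2)⁻¹ ≤ decayProfile a * decayProfile b * decayProfile c := by
  have hM : 0 < M := ha.trans_le haM
  by_cases hc1 : c ≤ 1
  · simp only [decayProfile, ha1, hb1, hc1, if_true]
    have key : ∀ s : ℝ, 0 < s → s ≤ M → M ^ (-(2 / 3) : ℝ) ≤ s ^ (-(2 / 3) : ℝ) :=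
      fun s hs hsM => Real.rpow_le_rpow_of_nonpos hs hsM (by norm_num)
    calc (M ^ 2)⁻¹ = M ^ (-(2 / 3) : ℝ) * M ^ (-(2 / 3) : ℝ) * M ^ (-(2 / 3) : ℝ) := by
          rw [← Real.rpow_add hM, ← Real.rpow_add hM]
          norm_num [Real.rpow_neg hM.le]
      _ ≤ _ := by
          exact mul_le_mul (mul_le_mul (key a ha haM) (key b hb hbM) (by positivity)
            (by positivity)) (key c hc hcM) (by positivity) (by positivity)
  · have h1 := one_le_decayProfile ha ha1
    have h2 := one_le_decayProfile hb hb1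
    have h3 : (M ^ 2)⁻¹ ≤ decayProfile c := by
      rw [decayProfile, if_neg hc1, Real.rpow_neg hc.le]
      norm_num
      gcongr
    have h4 := decayProfile_nonneg hc.le
    calc (M ^ 2)⁻¹ ≤ 1 * 1 * decayProfile c := by simpa using h3
      _ ≤ _ := by gcongr

/-- The kernel `1/|u|²` truncated to the infinite box `{|u₁| ≤ R, |u₂| ≤ R}`. -/
def boxKernel (R : ℝ) (u : R3) : ℝ := if |u 0| ≤ R ∧ |u 1| ≤ R then (‖u‖ ^ 2)⁻¹ else 0

lemma boxKernel_nonneg (R : ℝ) (u : R3) : 0 ≤ boxKernel R u := by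
  unfold boxKernel
  split_ifs <;> positivity

lemma measurable_boxKernel (R : ℝ) : Measurable (boxKernel R) := by
  refine Measurable.ite ?_ (by fun_prop) measurable_const
  refine IsClosed.measurableSet (IsClosed.inter ?_ ?_)
  · exact isClosed_le (f := fun u : R3 => |u 0|) (by fun_prop) continuous_const
  · exact isClosed_le (f := fun u : R3 => |u 1|) (by fun_prop) continuous_const

lemma integrable_boxKernel_one : Integrable (boxKernel 1) := by
  have hprod : Integrable (fun u : Fin 3 → ℝ => ∏ i, decayProfile |u i|) :=
    Integrable.fintype_prod (f := fun _ s => decayProfile |s|)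
      (fun _ => integrable_decayProfile_abs)
  have hmp := PiLp.volume_preserving_ofLp (Fin 3)
  have hprod' : Integrable (fun u : R3 => ∏ i, decayProfile |u i|) :=
    hmp.integrable_comp_of_integrable hprod
  have hne : ∀ᵐ u : R3, ∀ i, u i ≠ 0 := by
    have h : ∀ᵐ u : Fin 3 → ℝ, ∀ i, u i ≠ 0 :=
      ae_all_iff.2 fun i => Measure.ae_eval_ne _ i 0
    exact hmp.quasiMeasurePreserving.ae h
  refine hprod'.mono' (measurable_boxKernel 1).aestronglyMeasurable ?_
  filter_upwards [hne] with u hu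
  rw [Real.norm_of_nonneg (boxKernel_nonneg _ _), Fin.prod_univ_three]
  have hle : ∀ i, |u i| ≤ ‖u‖ := fun i => PiLp.norm_apply_le u i
  have hpos : ∀ i, 0 < |u i| := fun i => abs_pos.2 (hu i)
  unfold boxKernel
  split_ifs with h
  · exact inv_sq_le_decayProfile_prod (hpos 0) (hpos 1) (hpos 2) h.1 h.2 (hle 0) (hle 1) (hle 2)
  · have := fun i => decayProfile_nonneg (hpos i).le
    exact mul_nonneg (mul_nonneg (this 0) (this 1)) (this 2)

lemma boxKernel_smul {R : ℝ} (hR : 0 < R) (u : R3) :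
    boxKernel R (R • u) = (R ^ 2)⁻¹ * boxKernel 1 u := by
  have h : ∀ s : ℝ, |R * s| ≤ R ↔ |s| ≤ 1 := fun s => by
    rw [abs_mul, abs_of_pos hR, mul_le_iff_le_one_right hR]
  simp only [boxKernel, PiLp.smul_apply, smul_eq_mul, h, norm_smul, Real.norm_eq_abs,
    mul_pow, sq_abs, mul_inv, mul_ite, mul_zero]

lemma integrable_boxKernel {R : ℝ} (hR : 0 < R) : Integrable (boxKernel R) := by
  rw [← integrable_comp_smul_iff volume (boxKernel R) hR.ne']
  simp only [boxKernel_smul hR]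
  exact integrable_boxKernel_one.const_mul _

lemma integral_boxKernel {R : ℝ} (hR : 0 < R) :
    ∫ u, boxKernel R u = R * ∫ u, boxKernel 1 u := by
  have h := Measure.integral_comp_smul_of_nonneg volume (boxKernel R) R (hR := hR.le)
  simp only [boxKernel_smul hR, finrank_euclideanSpace, Fintype.card_fin, smul_eq_mul] at h
  rw [integral_const_mul] at h
  field_simp at h
  linarith

lemma norm_radialDir_le_one (x : R3) : ‖radialDir x‖ ≤ 1 := by
  have h : ‖(EuclideanSpace.equiv (Fin 3) ℝ).symm ![x 0, x 1, 0]‖ = rcyl x := by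
    rw [EuclideanSpace.norm_eq]
    simp [rcyl, Fin.sum_univ_three]
  have h0 : 0 ≤ rcyl x := Real.sqrt_nonneg _
  rw [radialDir, norm_smul, h, norm_inv, Real.norm_of_nonneg h0]
  exact inv_mul_le_one

lemma abs_inv_sub_inv_le {a b : ℝ} (ha : 0 ≤ a) (hb : 0 ≤ b) :
    |a⁻¹ - b⁻¹| ≤ |a - b| * ((a ^ 2)⁻¹ + (b ^ 2)⁻¹) := by
  rcases ha.eq_or_lt with rfl | ha
  · rcases hb.eq_or_lt with rfl | hb
    · simp
    · simp [abs_of_pos hb]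
      field_simp
      rfl
  rcases hb.eq_or_lt with rfl | hb
  · simp [abs_of_pos ha]
    field_simp
    rfl
  have h : a⁻¹ - b⁻¹ = (b - a) * (a⁻¹ * b⁻¹) := by field_simp
  rw [h, abs_mul, abs_sub_comm b a, abs_of_pos (by positivity : 0 < a⁻¹ * b⁻¹), ← inv_pow,
    ← inv_pow]
  gcongr
  nlinarith [sq_nonneg (a⁻¹ - b⁻¹), inv_pos.2 ha, inv_pos.2 hb]

section Potential

variable {d L : ℝ} {ρ : R3 → ℝ}

lemma density_mul_inv_sq_le (hnn : ∀ x, 0 ≤ ρ x) (hL : ∀ᵐ x : R3, ρ x ≤ L)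
    (hsupp : ∀ x : R3, d < rcyl x → ρ x = 0) {x : R3} (hx : rcyl x ≤ 2 * d) :
    ∀ᵐ y : R3, ρ y * (‖x - y‖ ^ 2)⁻¹ ≤ L * boxKernel (3 * d) (x - y) := by
  filter_upwards [hL] with y hy
  have hL0 : 0 ≤ L := (hnn y).trans hy
  by_cases hyd : d < rcyl y
  · rw [hsupp y hyd, zero_mul]
    exact mul_nonneg hL0 (boxKernel_nonneg _ _)
  · have h0 : |(x - y) 0| ≤ 3 * d := by
      have := abs_sub (x 0) (y 0)
      have := abs_coord_zero_le_rcyl x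
      have := abs_coord_zero_le_rcyl y
      simp only [PiLp.sub_apply]
      linarith
    have h1 : |(x - y) 1| ≤ 3 * d := by
      have := abs_sub (x 1) (y 1)
      have := abs_coord_one_le_rcyl x
      have := abs_coord_one_le_rcyl y
      simp only [PiLp.sub_apply]
      linarith
    rw [boxKernel, if_pos ⟨h0, h1⟩]
    gcongr

lemma integrable_density_div_norm (hd : 0 < d) (hρ : Integrable ρ) (hnn : ∀ x, 0 ≤ ρ x)
    (hL : ∀ᵐ x : R3, ρ x ≤ L) (hsupp : ∀ x : R3, d < rcyl x → ρ x = 0) {x : R3}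
    (hx : rcyl x ≤ 2 * d) : Integrable (fun y => ρ y / ‖x - y‖) := by
  have hk : Integrable (fun y => L * boxKernel (3 * d) (x - y)) :=
    ((integrable_boxKernel (by positivity)).comp_sub_left x).const_mul L
  refine (hρ.add hk).mono' ?_ ?_
  · simp only [div_eq_mul_inv]
    exact hρ.aestronglyMeasurable.mul
      (Measurable.aestronglyMeasurable (by fun_prop))
  · filter_upwards [density_mul_inv_sq_le hnn hL hsupp hx] with y hy
    rw [Real.norm_of_nonneg (div_nonneg (hnn y) (norm_nonneg _)), div_eq_mul_inv]
    have h1 : ‖x - y‖⁻¹ ≤ 1 + (‖x - y‖ ^ 2)⁻¹ := by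
      rw [← inv_pow]
      nlinarith [sq_nonneg (‖x - y‖⁻¹ - 1)]
    calc ρ y * ‖x - y‖⁻¹ ≤ ρ y * (1 + (‖x - y‖ ^ 2)⁻¹) := by
          gcongr
          exact hnn y
      _ = ρ y + ρ y * (‖x - y‖ ^ 2)⁻¹ := by ring
      _ ≤ _ := by
          simp only [Pi.add_apply]
          gcongr

/-- The Newtonian potential is Lipschitz on the cylinder of radius `2 * d`. -/
lemma abs_Bfull_sub_le (hd : 0 < d) (hρ : Integrable ρ) (hnn : ∀ x, 0 ≤ ρ x)
    (hL : ∀ᵐ x : R3, ρ x ≤ L) (hsupp : ∀ x : R3, d < rcyl x → ρ x = 0) {x z : R3}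
    (hx : rcyl x ≤ 2 * d) (hz : rcyl z ≤ 2 * d) :
    |Bfull ρ z - Bfull ρ x| ≤ 6 * (∫ u, boxKernel 1 u) * L * d * ‖z - x‖ := by
  have hd3 : 0 < 3 * d := by positivity
  have hk : ∀ w : R3, Integrable (fun y => L * boxKernel (3 * d) (w - y)) := fun w =>
    ((integrable_boxKernel hd3).comp_sub_left w).const_mul L
  have hki : ∀ w : R3, ∫ y, L * boxKernel (3 * d) (w - y) =
      L * (3 * d * ∫ u, boxKernel 1 u) := fun w => by
    rw [integral_const_mul, integral_sub_left_eq_self (boxKernel (3 * d)) volume w,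
      integral_boxKernel hd3]
  rw [Bfull, Bfull, ← integral_sub (integrable_density_div_norm hd hρ hnn hL hsupp hz)
    (integrable_density_div_norm hd hρ hnn hL hsupp hx), ← Real.norm_eq_abs]
  calc _ ≤ ∫ y, ‖z - x‖ *
        (L * boxKernel (3 * d) (z - y) + L * boxKernel (3 * d) (x - y)) := by
        refine norm_integral_le_of_norm_le (((hk z).add (hk x)).const_mul _) ?_
        filter_upwards [density_mul_inv_sq_le hnn hL hsupp hx,
          density_mul_inv_sq_le hnn hL hsupp hz] with y hyx hyz
        rw [div_eq_mul_inv, div_eq_mul_inv, ← mul_sub, norm_mul, Real.norm_of_nonneg (hnn y),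
          Real.norm_eq_abs]
        have h1 := abs_inv_sub_inv_le (norm_nonneg (z - y)) (norm_nonneg (x - y))
        have h2 : |‖z - y‖ - ‖x - y‖| ≤ ‖z - x‖ := by
          simpa using abs_norm_sub_norm_le (z - y) (x - y)
        calc ρ y * |‖z - y‖⁻¹ - ‖x - y‖⁻¹|
            ≤ ρ y * (‖z - x‖ * ((‖z - y‖ ^ 2)⁻¹ + (‖x - y‖ ^ 2)⁻¹)) := by
              refine mul_le_mul_of_nonneg_left (h1.trans ?_) (hnn y)
              gcongr
          _ = ‖z - x‖ * (ρ y * (‖z - y‖ ^ 2)⁻¹ + ρ y * (‖x - y‖ ^ 2)⁻¹) := by ring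
          _ ≤ _ := by gcongr
    _ = _ := by
        rw [integral_const_mul, integral_add (hk z) (hk x), hki, hki]
        ring

end Potential

/-- **Lemma 6.2.** For nonnegative `ρ ∈ L¹ ∩ L^∞` supported in the infinite cylinder
`{x₁² + x₂² ≤ d²}`, the cylindrical radial derivative of the Newtonian potential
satisfies `|(Bρ)_r(x)| ≤ C ‖ρ‖_∞ (d + r(x))` inside the cylinder; here `L` is any
a.e. upper bound of `ρ`. -/
theorem newtonian_potential_radial_derivative_bound :
    ∃ C > 0, ∀ (d L : ℝ) (ρ : R3 → ℝ),
      Integrable ρ → (∀ x, 0 ≤ ρ x) → (∀ᵐ x : R3, ρ x ≤ L) →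
      (∀ x : R3, d < rcyl x → ρ x = 0) →
      ∀ x : R3, rcyl x ≤ d →
        |lineDeriv ℝ (Bfull ρ) x (radialDir x)| ≤ C * L * (d + rcyl x) := by
  have hK : 0 ≤ ∫ u, boxKernel 1 u := integral_nonneg (boxKernel_nonneg 1)
  refine ⟨6 * (∫ u, boxKernel 1 u) + 1, by positivity, ?_⟩
  intro d L ρ hρ hnn hL hsupp x hx
  obtain ⟨y, hy⟩ := hL.exists
  have hL0 : 0 ≤ L := (hnn y).trans hy
  have hr : 0 ≤ rcyl x := Real.sqrt_nonneg _
  have hd0 : 0 ≤ d := hr.trans hx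
  rcases hr.eq_or_lt with h0 | h0
  · rw [radialDir, ← h0, inv_zero, zero_smul, lineDeriv_zero, abs_zero]
    positivity
  have hd : 0 < d := h0.trans_le hx
  have hcont : Continuous rcyl := by
    unfold rcyl
    fun_prop
  have hnear : ∀ᶠ z in 𝓝 x, rcyl z < 2 * d :=
    hcont.continuousAt.eventually_lt_const (by linarith)
  have hlip : ‖lineDeriv ℝ (Bfull ρ) x (radialDir x)‖ ≤
      6 * (∫ u, boxKernel 1 u) * L * d * ‖radialDir x‖ := by
    refine norm_lineDeriv_le_of_lip' ℝ (by positivity) ?_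
    filter_upwards [hnear] with z hz
    exact abs_Bfull_sub_le hd hρ hnn hL hsupp (by linarith) hz.le
  calc |lineDeriv ℝ (Bfull ρ) x (radialDir x)|
      ≤ 6 * (∫ u, boxKernel 1 u) * L * d * ‖radialDir x‖ := hlip
    _ ≤ 6 * (∫ u, boxKernel 1 u) * L * d * 1 := by
        gcongr
        exact norm_radialDir_le_one x
    _ ≤ (6 * (∫ u, boxKernel 1 u) + 1) * L * (d + rcyl x) := by
        rw [mul_one]
        gcongr <;> linarith
end
end
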